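/- arXiv:2507.04579 — 6 statements merged into one kernel-verified Lean document; each statement's English description precedes it below -/
import Mathlib

section
/- Let s ≥ 3 and n ≥ 30(s+1). If H is an F_5-free 3-graph on n vertices with matching number ν(H) ≤ s, then H has at most s·⌊(n−s)²/4⌋ edges. Moreover this bound is attained, i.e., the maximum number of edges of an F_5-free 3-graph on n vertices with matching number at most s equals s·⌊(n−s)²/4⌋. -/
open Finset

/-- `H` is a 3-graph: every edge is a 3-element subset of the vertex set. -/
def IsThreeGraph {n : ℕ} (H : Finset (Finset (Fin n))) : Prop :=
  ∀ e ∈ H, e.card = 3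

/-- `H` is `F₅`-free: there are no five distinct vertices `a b c d e` with
`{a,b,c}, {a,b,d}, {c,d,e} ∈ H`. -/
def F5Free {n : ℕ} (H : Finset (Finset (Fin n))) : Prop :=
  ¬ ∃ a b c d e : Fin n, ({a, b, c, d, e} : Finset (Fin n)).card = 5 ∧
      ({a, b, c} : Finset (Fin n)) ∈ H ∧ ({a, b, d} : Finset (Fin n)) ∈ H ∧
      ({c, d, e} : Finset (Fin n)) ∈ H

/-- The matching number of `H` is at most `s`: every family of pairwise disjoint
edges of `H` has at most `s` members. -/
def MatchingNumLE {n : ℕ} (H : Finset (Finset (Fin n))) (s : ℕ) : Prop :=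
  ∀ M ⊆ H, (∀ e ∈ M, ∀ f ∈ M, e ≠ f → Disjoint e f) → M.card ≤ s

theorem IsThreeGraph.ne_of_mem {n : ℕ} {H : Finset (Finset (Fin n))} (h3 : IsThreeGraph H)
    {a b c : Fin n} (h : {a, b, c} ∈ H) : a ≠ b ∧ a ≠ c ∧ b ≠ c := by
  have hc := h3 _ h
  have h2 (x y : Fin n) : #{x, y} < 3 := Nat.lt_succ_of_le card_le_two
  refine ⟨?_, ?_, ?_⟩ <;> rintro rfl
  · exact (h2 a c).ne (by simpa using hc)
  · exact (h2 b a).ne (by simpa using hc)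
  · exact (h2 a b).ne (by simpa using hc)

theorem F5Free.false_of_mem {n : ℕ} {H : Finset (Finset (Fin n))} (h3 : IsThreeGraph H)
    (hF : F5Free H) {a b c d e : Fin n} (h₁ : {a, b, c} ∈ H) (h₂ : {a, b, d} ∈ H)
    (h₃ : {c, d, e} ∈ H) (hea : e ≠ a) (heb : e ≠ b) : False := by
  obtain ⟨hab, hac, hbc⟩ := h3.ne_of_mem h₁
  obtain ⟨-, had, hbd⟩ := h3.ne_of_mem h₂
  obtain ⟨hcd, hce, hde⟩ := h3.ne_of_mem h₃
  refine hF ⟨a, b, c, d, e, ?_, h₁, h₂, h₃⟩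
  simp [Finset.card_insert_of_notMem, *, hea.symm, heb.symm]

/-- Through a vertex `v` outside an edge `f` there are at most `n` edges meeting `f`. -/
theorem F5Free.card_filter_meets_le {n : ℕ} {H : Finset (Finset (Fin n))} (h3 : IsThreeGraph H)
    (hF : F5Free H) {v : Fin n} {f : Finset (Fin n)} (hf : f ∈ H) (hv : v ∉ f) :
    #{e ∈ H | v ∈ e ∧ ¬ Disjoint e f} ≤ n := by
  have hform : ∀ e ∈ H, v ∈ e → ¬ Disjoint e f →
      (∃ x ∈ f, ∃ p ∉ f, e = {v, p, x}) ∨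
      (∃ x ∈ f, e = insert v (f.erase x)) := by
    intro e he hve hd
    obtain ⟨x, hxe, hxf⟩ := Finset.not_disjoint_iff.1 hd
    have hxv : x ≠ v := by rintro rfl; exact hv hxf
    have h1 : ((e.erase v).erase x).card = 1 := by
      rw [card_erase_of_mem (by simp [*]), card_erase_of_mem hve, h3 e he]
    obtain ⟨p, hp⟩ := card_eq_one.1 h1
    have he' : e = {v, p, x} := by
      rw [← insert_erase hve, ← insert_erase (show x ∈ e.erase v by simp [*]), hp]
      ext; simp; tauto
    by_cases hpf : p ∈ f
    · right
      have hpx : p ≠ x := by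
        rintro rfl
        have : p ∈ (e.erase v).erase p := by rw [hp]; simp
        simp at this
      have h2 : ((f.erase x).erase p).card = 1 := by
        rw [card_erase_of_mem (by simp [*]), card_erase_of_mem hxf, h3 f hf]
      obtain ⟨z, hz⟩ := card_eq_one.1 h2
      have hz' : z ∈ (f.erase x).erase p := by rw [hz]; simp
      simp only [mem_erase] at hz'
      refine ⟨z, hz'.2.2, ?_⟩
      have hf' : f = {x, p, z} := by
        rw [← insert_erase hxf, ← insert_erase (show p ∈ f.erase x by simp [*]), hz]
      rw [he', hf']
      ext y
      simp only [mem_insert, mem_singleton, mem_erase]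
      grind
    · exact .inl ⟨x, hxf, p, hpf, he'⟩
  have key : ∀ e ∈ ({e ∈ H | v ∈ e ∧ ¬ Disjoint e f} : Finset _), ∃ q : Fin n,
      (q ∉ f ∧ ∃ x ∈ f, e = {v, q, x}) ∨ (q ∈ f ∧ e = insert v (f.erase q)) := by
    intro e he
    simp only [mem_filter] at he
    rcases hform e he.1 he.2.1 he.2.2 with ⟨x, hx, p, hp, h⟩ | ⟨x, hx, h⟩
    · exact ⟨p, .inl ⟨hp, x, hx, h⟩⟩
    · exact ⟨x, .inr ⟨hx, h⟩⟩
  have : Nonempty (Fin n) := ⟨v⟩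
  choose! g hg using key
  calc _ ≤ #(univ : Finset (Fin n)) := by
        refine card_le_card_of_injOn g (fun _ _ => mem_univ _) ?_
        intro e he e' he' hee
        have h := hg e he
        have h' := hg e' he'
        rw [← hee] at h'
        simp only [coe_filter, Set.mem_ofPred_eq] at he he'
        rcases h with ⟨hq, x, hx, h⟩ | ⟨hq, h⟩ <;> rcases h' with ⟨hq', x', hx', h'⟩ | ⟨hq', h'⟩
        · by_cases hxx : x = x'
          · rw [h, h', hxx]
          exfalso
          have h2 : ((f.erase x).erase x').card = 1 := by
            rw [card_erase_of_mem (by simp [*, Ne.symm hxx]), card_erase_of_mem hx, h3 f hf]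
          obtain ⟨z, hz⟩ := card_eq_one.1 h2
          have hz' : z ∈ (f.erase x).erase x' := by rw [hz]; simp
          simp only [mem_erase] at hz'
          have hf' : f = {x, x', z} := by
            rw [← insert_erase hx, ← insert_erase (show x' ∈ f.erase x by simp [*, Ne.symm hxx]),
              hz]
          exact hF.false_of_mem h3 (h ▸ he.1) (h' ▸ he'.1) (hf' ▸ hf)
            (by rintro rfl; exact hv hz'.2.2) (by rintro h; exact hq (h ▸ hz'.2.2))
        · exact absurd hq' hq
        · exact absurd hq hq'
        · rw [h, h']
    _ = n := by simp

/-- Weighted Mantel bound: the weights are at most `A`, and a triangle of positive weights has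
total weight at most `T`. -/
theorem three_mul_sum_weight_le {V : Type*} [DecidableEq V] (w : V → V → ℕ) (A T Q : ℕ)
    (hsymm : ∀ x y, w x y = w y x) (hdiag : ∀ x, w x x = 0) (hAQ : 3 * A ≤ Q) (hTQ : 2 * T ≤ Q)
    (X : Finset V) (hA : ∀ x ∈ X, ∀ y ∈ X, w x y ≤ A)
    (hT : ∀ x ∈ X, ∀ y ∈ X, ∀ z ∈ X, 0 < w x y → 0 < w x z → 0 < w y z →
      w x y + w x z + w y z ≤ T) :
    3 * ∑ x ∈ X, ∑ y ∈ X, w x y ≤ 2 * (Q * (#X ^ 2 / 4)) := by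
  induction hm : #X using Nat.strong_induction_on generalizing X with
  | _ m ih =>
  by_cases h0 : ∀ p ∈ X ×ˢ X, w p.1 p.2 = 0
  · rw [← sum_product', sum_eq_zero h0]; simp
  push Not at h0
  obtain ⟨p₀, hp₀, hp₀w⟩ := h0
  obtain ⟨⟨x, y⟩, hxy, hmax⟩ := exists_max_image (X ×ˢ X) (fun p => w p.1 p.2) ⟨p₀, hp₀⟩
  have hpos : 0 < w x y := lt_of_lt_of_le (Nat.pos_of_ne_zero hp₀w) (hmax p₀ hp₀)
  obtain ⟨hx, hy⟩ := mem_product.1 hxy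
  simp only at hx hy
  have hne : x ≠ y := by rintro rfl; simp [hdiag] at hpos
  set Y := (X.erase x).erase y with hY
  have hyx : y ∈ X.erase x := by simp [hne.symm, hy]
  have hYX : Y ⊆ X := (erase_subset _ _).trans (erase_subset _ _)
  have hYc : #Y + 2 = m := by
    have h1 := card_erase_add_one hx
    have h2 := card_erase_add_one hyx
    rw [← hY] at h2
    omega
  have hsum : ∀ f : V → ℕ, ∑ z ∈ X, f z = f x + (f y + ∑ z ∈ Y, f z) := fun f => by
    rw [← add_sum_erase _ f hx, ← add_sum_erase _ f hyx]
  have hIH := ih #Y (by omega) Y (fun a ha b hb => hA a (hYX ha) b (hYX hb))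
    (fun a ha b hb c hc => hT a (hYX ha) b (hYX hb) c (hYX hc)) rfl
  have hcross : 3 * ∑ z ∈ Y, (w x z + w y z) ≤ #Y * Q := by
    rw [mul_sum, ← smul_eq_mul, ← sum_const]
    refine sum_le_sum fun z hz => ?_
    have hz := hYX hz
    have h1 := hmax (x, z) (by simp [hx, hz])
    have h2 := hmax (y, z) (by simp [hy, hz])
    simp only at h1 h2
    have h3 := hA x hx z hz
    have h4 := hA y hy z hz
    rcases Nat.eq_zero_or_pos (w x z) with h | h
    · omega
    rcases Nat.eq_zero_or_pos (w y z) with h' | h'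
    · omega
    have := hT x hx y hy z hz hpos h h'
    omega
  have hexp : ∑ a ∈ X, ∑ b ∈ X, w a b
      = 2 * w x y + 2 * ∑ z ∈ Y, (w x z + w y z) + ∑ a ∈ Y, ∑ b ∈ Y, w a b := by
    have h1 : ∑ z ∈ Y, w z x = ∑ z ∈ Y, w x z := sum_congr rfl fun z _ => hsymm z x
    have h2 : ∑ z ∈ Y, w z y = ∑ z ∈ Y, w y z := sum_congr rfl fun z _ => hsymm z y
    simp only [hsum, hdiag, sum_add_distrib, hsymm y x, h1, h2]
    ring
  have hp := hA x hx y hy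
  have hdiv : m ^ 2 / 4 = #Y ^ 2 / 4 + (#Y + 1) := by
    rw [← hYc, show (#Y + 2) ^ 2 = #Y ^ 2 + (#Y + 1) * 4 by ring,
      Nat.add_mul_div_right _ _ (by norm_num)]
  rw [hexp, hdiv]
  nlinarith

theorem IsThreeGraph.exists_eq_of_mem {n : ℕ} {H : Finset (Finset (Fin n))} (h3 : IsThreeGraph H)
    {e : Finset (Fin n)} (he : e ∈ H) {u v : Fin n} (huv : u ≠ v) (hu : u ∈ e) (hv : v ∈ e) :
    ∃ z, e = {u, v, z} := by
  have hv' : v ∈ e.erase u := by simp [huv.symm, hv]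
  have h1 : ((e.erase u).erase v).card = 1 := by
    rw [card_erase_of_mem hv', card_erase_of_mem hu, h3 e he]
  obtain ⟨z, hz⟩ := card_eq_one.1 h1
  exact ⟨z, by rw [← insert_erase hu, ← insert_erase hv', hz]⟩

theorem IsThreeGraph.card_filter_meets_meets_le {n : ℕ} {H : Finset (Finset (Fin n))}
    (h3 : IsThreeGraph H) (U B : Finset (Fin n)) :
    #{e ∈ H | ∃ u ∈ U, ∃ v ∈ B, u ≠ v ∧ u ∈ e ∧ v ∈ e} ≤ #U * #B * n := by
  calc _ ≤ #(((U ×ˢ B) ×ˢ (univ : Finset (Fin n))).image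
          fun p => ({p.1.1, p.1.2, p.2} : Finset (Fin n))) := by
        refine card_le_card fun e he => ?_
        simp only [mem_filter] at he
        obtain ⟨he, u, hu, v, hv, huv, hue, hve⟩ := he
        obtain ⟨z, rfl⟩ := h3.exists_eq_of_mem he huv hue hve
        exact mem_image.2 ⟨((u, v), z), by simp [hu, hv], rfl⟩
    _ ≤ _ := card_image_le.trans (by simp)

/-- A matching extends greedily along vertices of large degree. -/
theorem F5Free.exists_matching_of_large_degree {n : ℕ} {H : Finset (Finset (Fin n))}
    (h3 : IsThreeGraph H) (hF : F5Free H) (s : ℕ) (B : Finset (Fin n))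
    (hB : ∀ v ∈ B, s * n < #{e ∈ H | v ∈ e}) (M : Finset (Finset (Fin n))) (hM : M ⊆ H)
    (hdisj : ∀ e ∈ M, ∀ f ∈ M, e ≠ f → Disjoint e f) (hMB : ∀ e ∈ M, Disjoint e B)
    (hcard : #M + #B ≤ s + 1) :
    ∃ M' ⊆ H, (∀ e ∈ M', ∀ f ∈ M', e ≠ f → Disjoint e f) ∧ #M' = #M + #B := by
  induction B using Finset.induction_on generalizing M with
  | empty => exact ⟨M, hM, hdisj, by simp⟩
  | insert v B hv ih =>
    rw [card_insert_of_notMem hv] at hcard ⊢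
    have hvM : ∀ f ∈ M, v ∉ f := fun f hf h => disjoint_left.1 (hMB f hf) h (by simp)
    obtain ⟨e, he, hve, heB, heM⟩ : ∃ e ∈ H, v ∈ e ∧ Disjoint e B ∧ ∀ f ∈ M, Disjoint e f := by
      by_contra! hcon
      have hsub : ({e ∈ H | v ∈ e} : Finset (Finset (Fin n))) ⊆
          {e ∈ H | ∃ u ∈ ({v} : Finset (Fin n)), ∃ w ∈ B, u ≠ w ∧ u ∈ e ∧ w ∈ e} ∪
            M.biUnion fun f => {e ∈ H | v ∈ e ∧ ¬ Disjoint e f} := by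
        intro e he
        simp only [mem_filter] at he
        simp only [mem_union, mem_biUnion, mem_filter, mem_singleton, exists_eq_left]
        by_cases heB : Disjoint e B
        · obtain ⟨f, hf, hef⟩ := hcon e he.1 he.2 heB
          exact .inr ⟨f, hf, he.1, he.2, hef⟩
        · obtain ⟨w, hwe, hwB⟩ := not_disjoint_iff.1 heB
          exact .inl ⟨he.1, w, hwB, by rintro rfl; exact hv hwB, he.2, hwe⟩
      have h1 := (card_le_card hsub).trans (card_union_le _ _)
      have h2 := h3.card_filter_meets_meets_le {v} B
      have h4 := card_biUnion_le_card_mul M (fun f => {e ∈ H | v ∈ e ∧ ¬ Disjoint e f}) n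
        fun f hf => hF.card_filter_meets_le h3 (hM hf) (hvM f hf)
      have h5 := hB v (by simp)
      have h6 : (#B + #M) * n ≤ s * n := Nat.mul_le_mul_right _ (by omega)
      simp only [card_singleton, one_mul] at h2
      rw [add_mul] at h6
      omega
    have heM' : e ∉ M := fun h => hvM e h hve
    obtain ⟨M', h1, h2, h4⟩ := ih (fun w hw => hB w (by simp [hw])) (insert e M)
      (by simp [insert_subset_iff, he, hM])
      (by
        intro a ha b hb hab
        rcases mem_insert.1 ha with rfl | ha' <;> rcases mem_insert.1 hb with rfl | hb'
        · exact absurd rfl hab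
        · exact heM b hb'
        · exact (heM a ha').symm
        · exact hdisj a ha' b hb' hab)
      (by
        intro a ha
        rcases mem_insert.1 ha with rfl | ha
        · exact heB
        · exact (hMB a ha).mono_right (subset_insert _ _))
      (by rw [card_insert_of_notMem heM']; omega)
    exact ⟨M', h1, h2, by rw [h4, card_insert_of_notMem heM']; ring⟩

theorem MatchingNumLE.card_add_card_le {n : ℕ} {H : Finset (Finset (Fin n))}
    (h3 : IsThreeGraph H) (hF : F5Free H) {s : ℕ} (hs : MatchingNumLE H s) (B : Finset (Fin n))
    (hB : ∀ v ∈ B, s * n < #{e ∈ H | v ∈ e}) (M : Finset (Finset (Fin n))) (hM : M ⊆ H)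
    (hdisj : ∀ e ∈ M, ∀ f ∈ M, e ≠ f → Disjoint e f) (hMB : ∀ e ∈ M, Disjoint e B) :
    #M + #B ≤ s := by
  by_contra! hcon
  have hMs : #M ≤ s := hs M hM hdisj
  obtain ⟨B', hB', hc⟩ := exists_subset_card_eq (s := B) (n := s + 1 - #M) (by omega)
  obtain ⟨M', h1, h2, h4⟩ := hF.exists_matching_of_large_degree h3 s B' (fun v hv => hB v (hB' hv))
    M hM hdisj (fun e he => (hMB e he).mono_right hB') (by omega)
  have := hs M' h1 h2
  omega

/-- If no vertex outside `B` has degree more than `D`, the edges missing `B` are covered by the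
vertices of a maximal matching among them. -/
theorem IsThreeGraph.card_filter_disjoint_le {n : ℕ} {H : Finset (Finset (Fin n))}
    (h3 : IsThreeGraph H) (B : Finset (Fin n)) (D t : ℕ)
    (hD : ∀ v ∉ B, #{e ∈ H | v ∈ e} ≤ D)
    (ht : ∀ M ⊆ H, (∀ e ∈ M, ∀ f ∈ M, e ≠ f → Disjoint e f) → (∀ e ∈ M, Disjoint e B) →
      #M ≤ t) :
    #{e ∈ H | Disjoint e B} ≤ 3 * t * D := by
  obtain ⟨M, hM, hmax⟩ := exists_max_image
    {M ∈ ({e ∈ H | Disjoint e B} : Finset (Finset (Fin n))).powerset |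
      ∀ e ∈ M, ∀ f ∈ M, e ≠ f → Disjoint e f} card ⟨∅, by simp⟩
  simp only [mem_filter, mem_powerset] at hM hmax
  obtain ⟨hMH, hMd⟩ := hM
  have hMH' : ∀ e ∈ M, e ∈ H ∧ Disjoint e B := fun e he => by simpa using hMH he
  have hMt := ht M (fun e he => (hMH' e he).1) hMd fun e he => (hMH' e he).2
  have hsub : ({e ∈ H | Disjoint e B} : Finset (Finset (Fin n))) ⊆
      (M.biUnion id).biUnion fun v => {e ∈ H | v ∈ e} := by
    intro e he
    have he' := mem_filter.1 he
    simp only [mem_biUnion, mem_filter, id]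
    by_contra! hcon
    have hed : ∀ f ∈ M, Disjoint e f := fun f hf =>
      disjoint_left.2 fun x hxe hxf => hcon x ⟨f, hf, hxf⟩ he'.1 hxe
    have heM : e ∉ M := fun h => by
      have h1 := h3 e he'.1
      rw [disjoint_self_iff_empty e |>.1 (hed e h)] at h1
      simp at h1
    have := hmax (insert e M) ⟨insert_subset he hMH, by
      intro a ha b hb hab
      rcases mem_insert.1 ha with rfl | ha' <;> rcases mem_insert.1 hb with rfl | hb'
      · exact absurd rfl hab
      · exact hed b hb'
      · exact (hed a ha').symm
      · exact hMd a ha' b hb' hab⟩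
    rw [card_insert_of_notMem heM] at this
    omega
  have hV : #(M.biUnion id) ≤ #M * 3 :=
    card_biUnion_le_card_mul _ _ _ fun e he => (h3 e (hMH' e he).1).le
  calc _ ≤ #(M.biUnion id) * D := (card_le_card hsub).trans <|
        card_biUnion_le_card_mul _ _ _ fun v hv => by
          obtain ⟨e, he, hve⟩ := mem_biUnion.1 hv
          exact hD v fun h => disjoint_left.1 (hMH' e he).2 hve h
    _ ≤ _ := Nat.mul_le_mul_right _ (by omega)

/-- The vertices of `B` completing the pair `x, y` to an edge. -/
def colors {n : ℕ} (H : Finset (Finset (Fin n))) (B : Finset (Fin n)) (x y : Fin n) :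
    Finset (Fin n) :=
  {v ∈ B | {v, x, y} ∈ H}

theorem mem_colors {n : ℕ} {H : Finset (Finset (Fin n))} {B : Finset (Fin n)} {v x y : Fin n} :
    v ∈ colors H B x y ↔ v ∈ B ∧ {v, x, y} ∈ H := by
  simp [colors]

theorem colors_comm {n : ℕ} (H : Finset (Finset (Fin n))) (B : Finset (Fin n)) (x y : Fin n) :
    colors H B x y = colors H B y x := by
  ext v
  rw [mem_colors, mem_colors, pair_comm]

theorem IsThreeGraph.colors_self {n : ℕ} {H : Finset (Finset (Fin n))} (h3 : IsThreeGraph H)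
    (B : Finset (Fin n)) (x : Fin n) : colors H B x x = ∅ := by
  ext v
  simp only [mem_colors, notMem_empty, iff_false, not_and]
  exact fun _ h => (h3.ne_of_mem h).2.2 rfl

theorem IsThreeGraph.two_mul_card_le_sum_colors {n : ℕ} {H : Finset (Finset (Fin n))}
    (h3 : IsThreeGraph H) (B X : Finset (Fin n)) :
    2 * #{e ∈ H | ∃ v ∈ B, ∃ x ∈ X, ∃ y ∈ X, e = {v, x, y}} ≤
      ∑ x ∈ X, ∑ y ∈ X, #(colors H B x y) := by
  set H₁ : Finset (Finset (Fin n)) := {e ∈ H | ∃ v ∈ B, ∃ x ∈ X, ∃ y ∈ X, e = {v, x, y}} with hH₁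
  let r : Finset (Fin n) → Fin n × Fin n → Prop := fun e p => ∃ v ∈ B, e = {v, p.1, p.2}
  classical
  calc 2 * #H₁ = ∑ e ∈ H₁, 2 := by simp [mul_comm]
    _ ≤ ∑ e ∈ H₁, #(bipartiteAbove r (X ×ˢ X) e) := by
        refine sum_le_sum fun e he => ?_
        obtain ⟨heH, v, hv, x, hx, y, hy, rfl⟩ := mem_filter.1 he
        have hxy := (h3.ne_of_mem heH).2.2
        refine one_lt_card.2 ⟨(x, y), ?_, (y, x), ?_, by simp [hxy]⟩
        · simp only [mem_bipartiteAbove, mem_product]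
          exact ⟨⟨hx, hy⟩, v, hv, rfl⟩
        · simp only [mem_bipartiteAbove, mem_product]
          exact ⟨⟨hy, hx⟩, v, hv, by simp only [pair_comm]⟩
    _ = ∑ p ∈ X ×ˢ X, #(bipartiteBelow r H₁ p) :=
        sum_card_bipartiteAbove_eq_sum_card_bipartiteBelow r
    _ ≤ ∑ p ∈ X ×ˢ X, #(colors H B p.1 p.2) := by
        refine sum_le_sum fun p _ => ?_
        refine (card_le_card (t := (colors H B p.1 p.2).image fun v => {v, p.1, p.2}) ?_).trans
          card_image_le
        intro e he
        obtain ⟨he, v, hv, rfl⟩ := mem_bipartiteBelow _ |>.1 he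
        exact mem_image.2 ⟨v, mem_colors.2 ⟨hv, (mem_filter.1 he).1⟩, rfl⟩
    _ = _ := sum_product' X X fun x y => #(colors H B x y)

theorem F5Free.eq_of_mem_colors {n : ℕ} {H : Finset (Finset (Fin n))} (h3 : IsThreeGraph H)
    (hF : F5Free H) {B : Finset (Fin n)} {x y z c d : Fin n} (hx : x ∉ B)
    (h₁ : c ∈ colors H B x y) (h₂ : c ∈ colors H B x z) (h₃ : d ∈ colors H B y z) : d = c := by
  rw [mem_colors] at h₁ h₂ h₃
  by_contra hdc
  refine hF.false_of_mem h3 (e := d) h₁.2 h₂.2 ?_ hdc ?_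
  · convert h₃.2 using 1; ext; simp; tauto
  · rintro rfl; exact hx h₃.1

theorem F5Free.card_colors_triangle_le {n : ℕ} {H : Finset (Finset (Fin n))} (h3 : IsThreeGraph H)
    (hF : F5Free H) {B : Finset (Fin n)} {x y z : Fin n} (hx : x ∉ B) (hy : y ∉ B) (hz : z ∉ B)
    (hxy : 0 < #(colors H B x y)) (hxz : 0 < #(colors H B x z)) (hyz : 0 < #(colors H B y z)) :
    #(colors H B x y) + #(colors H B x z) + #(colors H B y z) ≤ max #B 3 := by
  have key : ∀ {x y z : Fin n}, x ∉ B → y ∉ B → z ∉ B → 0 < #(colors H B x y) →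
      0 < #(colors H B x z) → 0 < #(colors H B y z) →
      ¬ Disjoint (colors H B x y) (colors H B x z) →
      #(colors H B x y) ≤ 1 ∧ #(colors H B x z) ≤ 1 ∧ #(colors H B y z) ≤ 1 := by
    intro x y z hx hy hz hxy hxz hyz hd
    obtain ⟨c, hc₁, hc₂⟩ := not_disjoint_iff.1 hd
    have h₁ : ∀ d ∈ colors H B y z, d = c := fun d hd => hF.eq_of_mem_colors h3 hx hc₁ hc₂ hd
    obtain ⟨d, hd⟩ := card_pos.1 hyz
    obtain rfl := h₁ d hd
    have h₂ : ∀ e ∈ colors H B x z, e = d := fun e he =>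
      hF.eq_of_mem_colors h3 hy (colors_comm H B x y ▸ hc₁) hd he
    have h₄ : ∀ e ∈ colors H B x y, e = d := fun e he =>
      hF.eq_of_mem_colors h3 hz (colors_comm H B x z ▸ hc₂) (colors_comm H B y z ▸ hd) he
    exact ⟨card_le_one.2 fun a ha b hb => (h₄ a ha).trans (h₄ b hb).symm,
      card_le_one.2 fun a ha b hb => (h₂ a ha).trans (h₂ b hb).symm,
      card_le_one.2 fun a ha b hb => (h₁ a ha).trans (h₁ b hb).symm⟩
  by_cases h₁ : Disjoint (colors H B x y) (colors H B x z)
  · by_cases h₂ : Disjoint (colors H B x y) (colors H B y z)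
    · by_cases h₄ : Disjoint (colors H B x z) (colors H B y z)
      · rw [← card_union_of_disjoint h₁, ← card_union_of_disjoint (disjoint_union_left.2 ⟨h₂, h₄⟩)]
        refine (card_le_card ?_).trans (le_max_left _ _)
        intro v hv
        simp only [mem_union, mem_colors] at hv
        tauto
      · rw [colors_comm H B x z, colors_comm H B y z] at h₄
        have := key hz hx hy (colors_comm H B x z ▸ hxz) (colors_comm H B y z ▸ hyz) hxy h₄
        rw [colors_comm H B z x, colors_comm H B z y] at this
        omega
    · rw [colors_comm H B x y] at h₂
      have := key hy hx hz (colors_comm H B x y ▸ hxy) hyz hxz h₂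
      rw [colors_comm H B y x] at this
      omega
  · have := key hx hy hz hxy hxz hyz h₁
    omega

/-- Edges meeting `B` in disjoint sets of size at least two each exclude one color from every pair
they miss. -/
theorem F5Free.card_colors_add_card_le {n : ℕ} {H : Finset (Finset (Fin n))} (h3 : IsThreeGraph H)
    (hF : F5Free H) {B : Finset (Fin n)} {M : Finset (Finset (Fin n))} (hM : M ⊆ H)
    (hM2 : ∀ e ∈ M, 2 ≤ #(e ∩ B)) (hdisj : ∀ e ∈ M, ∀ f ∈ M, e ≠ f → Disjoint (e ∩ B) (f ∩ B))
    {x y : Fin n} (hx : ∀ e ∈ M, x ∉ e) (hy : ∀ e ∈ M, y ∉ e) :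
    #(colors H B x y) + #M ≤ #B := by
  have hex : ∀ e ∈ M, ∃ v ∈ e ∩ B, v ∉ colors H B x y := by
    intro e he
    by_contra! hcon
    obtain ⟨u, hu, v, hv, huv⟩ := one_lt_card.1 (hM2 e he)
    have hu' := hcon u hu
    have hv' := hcon v hv
    rw [mem_colors] at hu' hv'
    obtain ⟨z, rfl⟩ := h3.exists_eq_of_mem (hM he) huv (mem_inter.1 hu).1 (mem_inter.1 hv).1
    refine hF.false_of_mem h3 (a := x) (b := y) (c := u) (d := v) (e := z) ?_ ?_ (hM he) ?_ ?_
    · convert hu'.2 using 1; ext; simp; tauto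
    · convert hv'.2 using 1; ext; simp; tauto
    · rintro rfl; exact hx _ he (by simp)
    · rintro rfl; exact hy _ he (by simp)
  have : Nonempty (Fin n) := ⟨x⟩
  choose! g hg hgc using hex
  have hinj : Set.InjOn g M := by
    intro e he f hf hef
    by_contra hne
    exact disjoint_left.1 (hdisj e he f hf hne) (hg e he) (hef ▸ hg f hf)
  rw [← card_image_of_injOn hinj, ← card_union_of_disjoint]
  · refine card_le_card (union_subset (filter_subset _ _) ?_)
    intro v hv
    obtain ⟨e, he, rfl⟩ := mem_image.1 hv
    exact (mem_inter.1 (hg e he)).2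
  · refine disjoint_right.2 fun v hv => ?_
    obtain ⟨e, he, rfl⟩ := mem_image.1 hv
    exact hgc e he

/-- The numerical estimate: `b` vertices of large degree, `k` edges meeting them at least twice. -/
theorem count_bound {n s b k h : ℕ} (hs : 3 ≤ s) (hn : 30 * (s + 1) ≤ n) (hb : b ≤ s)
    (hk : 2 * k ≤ b)
    (hh : 3 * h ≤ max (3 * (b - k)) (2 * (if b = 0 then 0 else max b 3)) * ((n - b) ^ 2 / 4)) :
    3 * (s - b) * (s * n) + 3 * k * b * n + h ≤ s * ((n - s) ^ 2 / 4) := by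
  obtain ⟨t, rfl⟩ := Nat.exists_eq_add_of_le hb
  obtain ⟨r, rfl⟩ := Nat.exists_eq_add_of_le (show b + t ≤ n by omega)
  rw [show b + t - b = t by omega, show b + t + r - (b + t) = r by omega]
  rw [show b + t + r - b = r + t by omega] at hh
  have hF : r ^ 2 ≤ 4 * (r ^ 2 / 4) + 3 := by omega
  have hG : 4 * ((r + t) ^ 2 / 4) ≤ (r + t) ^ 2 := by omega
  rcases Nat.eq_zero_or_pos (t + k) with h0 | h0
  · obtain ⟨rfl, rfl⟩ : t = 0 ∧ k = 0 := by omega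
    simp only [add_zero, Nat.sub_zero] at *
    rw [if_neg (by omega), max_eq_left (a := b) (by omega), max_eq_left (by omega)] at hh
    nlinarith
  generalize (r + t) ^ 2 / 4 = G at *
  generalize r ^ 2 / 4 = F at *
  have hr : 29 * (b + t) + 30 ≤ r := by omega
  have hsr : 29 * ((b + t) * r) + 30 * r ≤ r ^ 2 := by linarith [Nat.mul_le_mul_right r hr]
  have hss : 29 * (b + t) ^ 2 + 30 * (b + t) ≤ (b + t) * r := by
    linarith [Nat.mul_le_mul_left (b + t) hr]
  have hrr : 117 * r ≤ r ^ 2 := by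
    linarith [Nat.mul_le_mul_right r (show 117 ≤ r by omega)]
  have hrS : 3 * r ≤ (b + t) * r := Nat.mul_le_mul_right _ hs
  have hSS : (b + t) * 3 ≤ (b + t) * (b + t) := Nat.mul_le_mul_left _ hs
  have hsq : (r + t) ^ 2 ≤ r ^ 2 + t * (2 * r + (b + t)) := by
    linarith [Nat.zero_le (t * b)]
  have hkey₁ : 12 * ((b + t) * (b + t + r)) + (b + t) * (2 * r + (b + t)) + 3 * (b + t)
      ≤ r ^ 2 := by
    linarith
  have hkey₂ : 36 * ((b + t) * (b + t + r)) + 2 * (b + t) * (2 * r + (b + t)) + 9 * (b + t)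
      ≤ 3 * r ^ 2 := by
    linarith
  have hkey₃ : 18 * ((b + t) * (b + t + r)) + 3 * (b + t) ≤ r ^ 2 := by linarith
  have hkey₄ : 72 * ((b + t) * (b + t + r)) + 12 * (2 * r + (b + t)) + 9 * (b + t) ≤ 3 * r ^ 2 := by
    linarith
  have hkey₅ : 60 * ((b + t) * (b + t + r)) + 6 * (2 * r + (b + t)) + 9 * (b + t) ≤ 3 * r ^ 2 := by
    linarith
  rcases Nat.eq_zero_or_pos b with rfl | hb0
  · obtain rfl : k = 0 := by omega
    simp only [if_true, mul_zero, Nat.sub_zero, max_self, zero_mul, zero_add] at *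
    have h1 : 3 * (t * (t + r)) ≤ F := by linarith [Nat.zero_le (t * (2 * r + t))]
    have h2 := Nat.mul_le_mul_left t h1
    have h3 : h = 0 := by simpa using hh
    rw [h3]
    linarith
  rw [if_neg (by omega)] at hh
  obtain ⟨a, rfl⟩ := Nat.exists_eq_add_of_le (show k ≤ b by omega)
  rw [show k + a - k = a by omega] at hh
  generalize hS : k + a + t = S at *
  set E := 2 * r + S with hE
  have hN : (k + a) * (S + r) ≤ S * (S + r) := Nat.mul_le_mul_right _ hb
  rcases le_total (2 * max (k + a) 3) (3 * a) with hm | hm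
  · rw [max_eq_left hm] at hh
    have h1 : a * (4 * G) ≤ a * (r ^ 2 + t * E) := Nat.mul_le_mul_left _ (hG.trans hsq)
    have h2 : a * (t * E) ≤ S * (t * E) := Nat.mul_le_mul_right _ (by omega)
    have h4 : k * ((k + a) * (S + r)) ≤ k * (S * (S + r)) := Nat.mul_le_mul_left _ hN
    have h5 := Nat.mul_le_mul_left (t + k) hkey₁
    have h6 : 1 * S ≤ (t + k) * S := Nat.mul_le_mul_right _ h0
    have h7 : S * r ^ 2 ≤ S * (4 * F + 3) := Nat.mul_le_mul_left _ hF
    have h8 : S * r ^ 2 = (k + a + t) * r ^ 2 := by rw [hS]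
    have h9 : 0 ≤ k * (S * E) := Nat.zero_le _
    linarith
  rw [max_eq_right hm] at hh
  rcases le_or_gt 3 (k + a) with hb3 | hb3
  · rw [max_eq_left hb3] at hh
    have h1 : (k + a) * (4 * G) ≤ (k + a) * (r ^ 2 + t * E) := Nat.mul_le_mul_left _ (hG.trans hsq)
    have h2 : (k + a) * (t * E) ≤ S * (t * E) := Nat.mul_le_mul_right _ hb
    have h4 : 2 * k * ((k + a) * (S + r)) ≤ (k + a) * (S * (S + r)) :=
      (Nat.mul_le_mul_right _ hk).trans (Nat.mul_le_mul_left _ hN)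
    have h5 := Nat.mul_le_mul_left t hkey₂
    have h6 := Nat.mul_le_mul_left (k + a) hkey₃
    have h7 : S * r ^ 2 ≤ S * (4 * F + 3) := Nat.mul_le_mul_left _ hF
    have h8 : S * r ^ 2 = (k + a + t) * r ^ 2 := by rw [hS]
    have h9 : 3 * S ≤ (k + a) * S := Nat.mul_le_mul_right _ hb3
    have h10 : 0 ≤ t * S := Nat.zero_le _
    linarith
  rw [max_eq_right hb3.le] at hh
  have h7 : S * r ^ 2 ≤ S * (4 * F + 3) := Nat.mul_le_mul_left _ hF
  have h8 : S * r ^ 2 = (k + a + t) * r ^ 2 := by rw [hS]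
  obtain ⟨rfl, rfl⟩ | hb2 : (k = 0 ∧ a = 1) ∨ k + a = 2 := by omega
  · have h5 := Nat.mul_le_mul_left t hkey₄
    have h6 : 2 * r ^ 2 ≤ t * r ^ 2 := Nat.mul_le_mul_right _ (by omega)
    have h9 : 2 * S ≤ t * S := Nat.mul_le_mul_right _ (by omega)
    linarith
  · rw [hb2] at h8 ⊢
    have h4 : k * (S + r) ≤ 1 * (S + r) := Nat.mul_le_mul_right _ (by omega)
    have h5 := Nat.mul_le_mul_left t hkey₅
    have h6 : 3 * (S + r) ≤ S * (S + r) := Nat.mul_le_mul_right _ hs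
    have h9 : 1 * S ≤ t * S := Nat.mul_le_mul_right _ (by omega)
    have h10 : 1 * (S * (S + r)) ≤ t * (S * (S + r)) := Nat.mul_le_mul_right _ (by omega)
    linarith

theorem card_le_of_F5Free_of_matchingNumLE {n s : ℕ} (hs : 3 ≤ s) (hn : 30 * (s + 1) ≤ n)
    {H : Finset (Finset (Fin n))} (h3 : IsThreeGraph H) (hF : F5Free H)
    (hν : MatchingNumLE H s) : #H ≤ s * ((n - s) ^ 2 / 4) := by
  set B : Finset (Fin n) := {v | s * n < #{e ∈ H | v ∈ e}} with hBdef
  have hB : ∀ v ∈ B, s * n < #{e ∈ H | v ∈ e} := fun v hv => by simpa [hBdef] using hv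
  have hb : #B ≤ s := by simpa using hν.card_add_card_le h3 hF B hB ∅ (by simp) (by simp) (by simp)
  have h0 : #{e ∈ H | Disjoint e B} ≤ 3 * (s - #B) * (s * n) :=
    h3.card_filter_disjoint_le B _ _ (fun v hv => by simpa [hBdef] using hv) fun M hM hd hMB => by
      have := hν.card_add_card_le h3 hF B hB M hM hd hMB
      omega
  obtain ⟨M, hM, hmax⟩ := exists_max_image {M ∈ H.powerset | (∀ e ∈ M, 2 ≤ #(e ∩ B)) ∧
    ∀ e ∈ M, ∀ f ∈ M, e ≠ f → Disjoint (e ∩ B) (f ∩ B)} card ⟨∅, by simp⟩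
  simp only [mem_filter, mem_powerset] at hM hmax
  obtain ⟨hMH, hM2, hMd⟩ := hM
  have hk : 2 * #M ≤ #B := by
    calc 2 * #M = ∑ e ∈ M, 2 := by simp [mul_comm]
      _ ≤ ∑ e ∈ M, #(e ∩ B) := sum_le_sum hM2
      _ = #(M.biUnion fun e => e ∩ B) := (card_biUnion hMd).symm
      _ ≤ #B := card_le_card (biUnion_subset.2 fun e _ => inter_subset_right)
  set U := M.biUnion id with hUdef
  have hU : #U ≤ #M * 3 := card_biUnion_le_card_mul _ _ _ fun e he => (h3 e (hMH he)).le
  have hmU : ∀ e ∈ M, ∀ x ∈ e, x ∈ U := fun e he x hx => mem_biUnion.2 ⟨e, he, hx⟩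
  set X : Finset (Fin n) := (B ∪ U)ᶜ with hX
  have hXB : ∀ x ∈ X, x ∉ B := fun x hx h => by simp [hX, h] at hx
  have hXU : ∀ x ∈ X, x ∉ U := fun x hx h => by simp [hX, h] at hx
  have hXc : #X ≤ n - #B := by
    rw [hX, card_compl, Fintype.card_fin]
    exact Nat.sub_le_sub_left (card_le_card subset_union_left) _
  have hcover : H ⊆ ({e ∈ H | Disjoint e B} : Finset (Finset (Fin n))) ∪
      {e ∈ H | ∃ u ∈ U, ∃ v ∈ B, u ≠ v ∧ u ∈ e ∧ v ∈ e} ∪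
      {e ∈ H | ∃ v ∈ B, ∃ x ∈ X, ∃ y ∈ X, e = {v, x, y}} := by
    intro e he
    simp only [mem_union, mem_filter, he, true_and]
    by_contra! hcon
    obtain ⟨⟨hd, hbad⟩, hgood⟩ := hcon
    obtain ⟨v, hve, hvB⟩ := not_disjoint_iff.1 hd
    have hone : #(e ∩ B) ≤ 1 := by
      by_contra! htwo
      obtain ⟨u, hue, huB, huU⟩ : ∃ u ∈ e, u ∈ B ∧ u ∈ U := by
        by_contra! hno
        have heM : e ∉ M := fun h => hno v hve hvB (hmU e h v hve)
        have hef : ∀ f ∈ M, Disjoint (e ∩ B) (f ∩ B) := fun f hf => disjoint_left.2 fun x hx hx' =>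
          hno x (mem_inter.1 hx).1 (mem_inter.1 hx).2 (hmU f hf x (mem_inter.1 hx').1)
        have := hmax (insert e M) ⟨insert_subset he hMH, by
          simpa using ⟨htwo, hM2⟩, by
          intro a ha b hb hab
          rcases mem_insert.1 ha with rfl | ha' <;> rcases mem_insert.1 hb with rfl | hb'
          · exact absurd rfl hab
          · exact hef b hb'
          · exact (hef a ha').symm
          · exact hMd a ha' b hb' hab⟩
        rw [card_insert_of_notMem heM] at this
        omega
      obtain ⟨w, hw, hwu⟩ := exists_mem_ne htwo u
      exact hbad u huU w (mem_inter.1 hw).2 hwu.symm hue (mem_inter.1 hw).1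
    obtain ⟨x, hx⟩ : ∃ x ∈ e, x ≠ v := exists_mem_ne (by rw [h3 e he]; norm_num) v
    obtain ⟨y, rfl⟩ := h3.exists_eq_of_mem he hx.2.symm hve hx.1
    obtain ⟨hvx, hvy, hxy⟩ := h3.ne_of_mem he
    have hXmem : ∀ z ∈ ({v, x, y} : Finset (Fin n)), z ≠ v → z ∈ X := by
      intro z hz hzv
      simp only [hX, mem_compl, mem_union, not_or]
      refine ⟨fun hzB => ?_, fun hzU => hbad z hzU v hvB hzv hz hve⟩
      exact hzv (card_le_one.1 hone z (mem_inter.2 ⟨hz, hzB⟩) v (mem_inter.2 ⟨hve, hvB⟩))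
    exact hgood v hvB x (hXmem x (by simp) hvx.symm) y (hXmem y (by simp) hvy.symm) rfl
  have hcount := (card_le_card hcover).trans
    ((card_union_le _ _).trans (Nat.add_le_add_right (card_union_le _ _) _))
  have hbad : #{e ∈ H | ∃ u ∈ U, ∃ v ∈ B, u ≠ v ∧ u ∈ e ∧ v ∈ e} ≤ 3 * #M * #B * n :=
    (h3.card_filter_meets_meets_le U B).trans <|
      Nat.mul_le_mul_right _ (Nat.mul_le_mul_right _ (by omega))
  have hsum := h3.two_mul_card_le_sum_colors B X
  set T := if #B = 0 then 0 else max #B 3 with hT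
  have hweight := three_mul_sum_weight_le (fun x y => #(colors H B x y)) (#B - #M) T
    (max (3 * (#B - #M)) (2 * T)) (fun x y => by simp only [colors_comm H B x y])
    (fun x => by simp [h3.colors_self]) (le_max_left _ _) (le_max_right _ _) X
    (fun x hx y hy => by
      have := hF.card_colors_add_card_le h3 hMH hM2 hMd (x := x) (y := y)
        (fun e he h => hXU x hx (hmU e he x h)) (fun e he h => hXU y hy (hmU e he y h))
      omega)
    (fun x hx y hy z hz hxy hxz hyz => by
      have h1 := hF.card_colors_triangle_le h3 (hXB x hx) (hXB y hy) (hXB z hz) hxy hxz hyz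
      have h2 : #(colors H B x y) ≤ #B := card_le_card (filter_subset _ _)
      rwa [hT, if_neg (by omega)])
  have hmono : #X ^ 2 / 4 ≤ (n - #B) ^ 2 / 4 := Nat.div_le_div_right (Nat.pow_le_pow_left hXc 2)
  have hfin := count_bound (h := #{e ∈ H | ∃ v ∈ B, ∃ x ∈ X, ∃ y ∈ X, e = {v, x, y}}) hs hn hb hk
    (by
      rw [← hT]
      have := Nat.mul_le_mul_left (max (3 * (#B - #M)) (2 * T)) hmono
      omega)
  omega

theorem exists_F5Free_card_eq {n s : ℕ} (hn : s ≤ n) :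
    ∃ H : Finset (Finset (Fin n)), IsThreeGraph H ∧ F5Free H ∧ MatchingNumLE H s ∧
      #H = s * ((n - s) ^ 2 / 4) := by
  set p := (n - s) / 2 with hp
  let col : Fin n → Fin 3 := fun i => if (i : ℕ) < s then 0 else if (i : ℕ) < s + p then 1 else 2
  let P : Fin 3 → Finset (Fin n) := fun j => {i | col i = j}
  have hP : ∀ j i, i ∈ P j ↔ col i = j := fun j i => by simp [P]
  have hP0 : #(P 0) = s := by
    have : P 0 = ({i | (i : ℕ) < s} : Finset (Fin n)) := by
      ext i; simp only [hP, col, mem_filter, mem_univ, true_and]; split_ifs <;> simp_all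
    rw [this, Fin.card_filter_val_lt]; omega
  have hP1 : #(P 0 ∪ P 1) = s + p := by
    have : P 0 ∪ P 1 = ({i | (i : ℕ) < s + p} : Finset (Fin n)) := by
      ext i; simp only [mem_union, hP, col, mem_filter, mem_univ, true_and]
      split_ifs <;> simp <;> omega
    rw [this, Fin.card_filter_val_lt]; omega
  have hdisj : ∀ i j, i ≠ j → Disjoint (P i) (P j) := fun i j hij => disjoint_left.2 fun x hx hy =>
    hij (((hP _ _).1 hx).symm.trans ((hP _ _).1 hy))
  have hP2 : #((P 0 ∪ P 1) ∪ P 2) = n := by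
    have : (P 0 ∪ P 1) ∪ P 2 = univ := by
      ext i; simp only [mem_union, hP, mem_univ, iff_true]
      generalize col i = j
      fin_cases j <;> simp
    rw [this]; simp
  rw [card_union_of_disjoint (disjoint_union_left.2 ⟨hdisj 0 2 (by decide), hdisj 1 2 (by decide)⟩),
    hP1] at hP2
  rw [card_union_of_disjoint (hdisj 0 1 (by decide)), hP0] at hP1
  let H := (P 0 ×ˢ P 1 ×ˢ P 2).image fun q => ({q.1, q.2.1, q.2.2} : Finset (Fin n))
  have hH : ∀ e, e ∈ H ↔ ∃ x y z, col x = 0 ∧ col y = 1 ∧ col z = 2 ∧ e = {x, y, z} := by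
    intro e
    simp only [H, mem_image, mem_product, hP, Prod.exists]
    constructor
    · rintro ⟨x, y, z, ⟨hx, hy, hz⟩, rfl⟩; exact ⟨x, y, z, hx, hy, hz, rfl⟩
    · rintro ⟨x, y, z, hx, hy, hz, rfl⟩; exact ⟨x, y, z, ⟨hx, hy, hz⟩, rfl⟩
  have hrain : ∀ e ∈ H, ∀ x ∈ e, ∀ y ∈ e, col x = col y → x = y := by
    intro e he
    obtain ⟨x, y, z, hx, hy, hz, rfl⟩ := (hH e).1 he
    simp only [mem_insert, mem_singleton]
    rintro a (rfl | rfl | rfl) b (rfl | rfl | rfl) <;> simp [hx, hy, hz]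
  have h3 : IsThreeGraph H := by
    intro e he
    obtain ⟨x, y, z, hx, hy, hz, rfl⟩ := (hH e).1 he
    refine card_eq_three.2 ⟨x, y, z, ?_, ?_, ?_, rfl⟩ <;> rintro rfl <;> simp_all
  refine ⟨H, h3, ?_, ?_, ?_⟩
  · rintro ⟨a, b, c, d, e, -, h₁, h₂, h₃⟩
    obtain ⟨hab, hac, hbc⟩ := h3.ne_of_mem h₁
    obtain ⟨-, had, hbd⟩ := h3.ne_of_mem h₂
    have hcd := (h3.ne_of_mem h₃).1
    have e1 : col a ≠ col b := fun h => hab (hrain _ h₁ a (by simp) b (by simp) h)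
    have e2 : col a ≠ col c := fun h => hac (hrain _ h₁ a (by simp) c (by simp) h)
    have e3 : col b ≠ col c := fun h => hbc (hrain _ h₁ b (by simp) c (by simp) h)
    have e4 : col a ≠ col d := fun h => had (hrain _ h₂ a (by simp) d (by simp) h)
    have e5 : col b ≠ col d := fun h => hbd (hrain _ h₂ b (by simp) d (by simp) h)
    have e6 : col c ≠ col d := fun h => hcd (hrain _ h₃ c (by simp) d (by simp) h)
    omega
  · intro M hM hd
    have hex : ∀ e ∈ M, ∃ x ∈ e, x ∈ P 0 := fun e he => by
      obtain ⟨x, y, z, hx, hy, hz, rfl⟩ := (hH e).1 (hM he)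
      exact ⟨x, by simp, (hP _ _).2 hx⟩
    rw [← hP0]
    by_cases hne : Nonempty (Fin n)
    · choose! g hg hg0 using hex
      refine card_le_card_of_injOn g hg0 fun e he f hf hef => ?_
      by_contra hne
      exact disjoint_left.1 (hd e he f hf hne) (hg e he) (hef ▸ hg f hf)
    · have : M = ∅ := eq_empty_of_forall_notMem fun e he => hne ⟨(hex e he).choose⟩
      simp [this]
  · have hinj : Set.InjOn (fun q : Fin n × Fin n × Fin n => ({q.1, q.2.1, q.2.2} : Finset (Fin n)))
        (P 0 ×ˢ P 1 ×ˢ P 2 : Finset _) := by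
      rintro ⟨x, y, z⟩ h ⟨x', y', z'⟩ h' heq
      simp only [coe_product, Set.mem_prod, mem_coe, hP] at h h' heq
      have he : ({x', y', z'} : Finset (Fin n)) ∈ H :=
        (hH _).2 ⟨x', y', z', h'.1, h'.2.1, h'.2.2, rfl⟩
      have hx : x ∈ ({x', y', z'} : Finset (Fin n)) := heq ▸ by simp
      have hy : y ∈ ({x', y', z'} : Finset (Fin n)) := heq ▸ by simp
      have hz : z ∈ ({x', y', z'} : Finset (Fin n)) := heq ▸ by simp
      rw [hrain _ he x hx x' (by simp) (h.1.trans h'.1.symm),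
        hrain _ he y hy y' (by simp) (h.2.1.trans h'.2.1.symm),
        hrain _ he z hz z' (by simp) (h.2.2.trans h'.2.2.symm)]
    rw [card_image_of_injOn hinj, card_product, card_product, hP0]
    congr 1
    have h1 : #(P 1) = p := by omega
    rcases Nat.even_or_odd' (n - s) with ⟨q, hq | hq⟩
    · have h2 : #(P 2) = q := by omega
      rw [h1, h2, hq, show p = q by omega, show (2 * q) ^ 2 = q * q * 4 by ring]
      simp
    · have h2 : #(P 2) = q + 1 := by omega
      rw [h1, h2, hq, show p = q by omega, show (2 * q + 1) ^ 2 = 1 + q * (q + 1) * 4 by ring,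
        Nat.add_mul_div_right _ _ (by norm_num)]
      simp

theorem ex3_F5_matching (n s : ℕ) (hs : 3 ≤ s) (hn : 30 * (s + 1) ≤ n) :
    (∀ H : Finset (Finset (Fin n)), IsThreeGraph H → F5Free H → MatchingNumLE H s →
      H.card ≤ s * ((n - s) ^ 2 / 4)) ∧
    (∃ H : Finset (Finset (Fin n)), IsThreeGraph H ∧ F5Free H ∧ MatchingNumLE H s ∧
      H.card = s * ((n - s) ^ 2 / 4)) :=
  ⟨fun _ h3 hF hν => card_le_of_F5Free_of_matchingNumLE hs hn h3 hF hν,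
    exists_F5Free_card_eq (by omega)⟩
end

section
/- Let s ∈ {1,2} and n ≥ 60. If H is an F_5-free 3-graph on vertex set [n] with matching number ν(H) ≤ s, then H has at most C(n−1,2) edges; moreover, equality holds if and only if H is a full star, i.e., H = { E ∈ C([n],3) : x ∈ E } for some vertex x ∈ [n]. -/
open Finset

/-- The full star with center `x`: all 3-element subsets containing `x`. -/
def fullStar (n : ℕ) (x : Fin n) : Finset (Finset (Fin n)) :=
  (Finset.powersetCard 3 (Finset.univ : Finset (Fin n))).filter (fun e => x ∈ e)

theorem two_mul_choose_two (m : ℕ) : 2 * (m + 1).choose 2 = (m + 1) * m := by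
  induction m with
  | zero => rfl
  | succ k ih =>
    rw [Nat.choose_succ_succ' (k + 1) 1, Nat.choose_one_right]
    linarith

theorem Finset.eq_triple_of_card_eq_three {α : Type*} [DecidableEq α] {e : Finset α}
    (he : #e = 3) {a b c : α} (ha : a ∈ e) (hb : b ∈ e) (hc : c ∈ e)
    (hab : a ≠ b) (hac : a ≠ c) (hbc : b ≠ c) : e = {a, b, c} := by
  refine (eq_of_subset_of_card_le ?_ ?_).symm
  · simp [insert_subset_iff, ha, hb, hc]
  · rw [he, card_eq_three.2 ⟨a, b, c, hab, hac, hbc, rfl⟩]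

theorem Finset.exists_eq_triple_of_card_eq_three {α : Type*} [DecidableEq α] {e : Finset α}
    (he : #e = 3) {a b : α} (ha : a ∈ e) (hb : b ∈ e) (hab : a ≠ b) :
    ∃ c, a ≠ c ∧ b ≠ c ∧ e = {a, b, c} := by
  obtain ⟨c, hc, hc'⟩ : ∃ c ∈ e, c ∉ ({a, b} : Finset α) := by
    by_contra! h
    have := card_le_card (show e ⊆ {a, b} from h)
    have := card_le_two (a := a) (b := b)
    omega
  simp only [mem_insert, mem_singleton, not_or] at hc'
  exact ⟨c, Ne.symm hc'.1, Ne.symm hc'.2,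
    eq_triple_of_card_eq_three he ha hb hc hab (Ne.symm hc'.1) (Ne.symm hc'.2)⟩

theorem Finset.triple_sdiff_pair {α : Type*} [DecidableEq α] {a c d x y : α}
    (ha : a ∈ ({x, y} : Finset α)) (hcx : c ≠ x) (hcy : c ≠ y) (hdx : d ≠ x) (hdy : d ≠ y) :
    ({a, c, d} : Finset α) \ {x, y} = {c, d} := by
  rw [insert_sdiff_of_mem _ ha, sdiff_eq_self_iff_disjoint]
  simp [*, hcx.symm, hcy.symm, hdx.symm, hdy.symm]

theorem Finset.exists_eq_triple_of_mem {α : Type*} [DecidableEq α] {e : Finset α}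
    (he : #e = 3) {a : α} (ha : a ∈ e) :
    ∃ b c, a ≠ b ∧ a ≠ c ∧ b ≠ c ∧ e = {a, b, c} := by
  obtain ⟨b, hb, hba⟩ := exists_mem_ne (by omega : 1 < #e) a
  obtain ⟨c, hac, hbc, h⟩ := exists_eq_triple_of_card_eq_three he ha hb hba.symm
  exact ⟨b, c, hba.symm, hac, hbc, h⟩

section

variable {n : ℕ} {H : Finset (Finset (Fin n))}

theorem card_fullStar (x : Fin n) : #(fullStar n x) = (n - 1).choose 2 := by
  have h : fullStar n x = (powersetCard 2 (univ.erase x)).image (insert x) := by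
    ext f
    simp only [fullStar, mem_filter, mem_powersetCard, mem_image, subset_univ, true_and]
    constructor
    · rintro ⟨hf, hx⟩
      refine ⟨f.erase x, ⟨erase_subset_erase _ (subset_univ _), ?_⟩, insert_erase hx⟩
      rw [card_erase_of_mem hx, hf]
    · rintro ⟨g, ⟨hg, hc⟩, rfl⟩
      have hx : x ∉ g := fun h => by simpa using hg h
      exact ⟨by rw [card_insert_of_notMem hx, hc], mem_insert_self _ _⟩
  rw [h, card_image_of_injOn, card_powersetCard, card_erase_of_mem (mem_univ _), card_univ,
    Fintype.card_fin]
  intro f hf g hg hfg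
  simp only [mem_coe, mem_powersetCard] at hf hg
  have hxf : x ∉ f := fun h => by simpa using hf.1 h
  have hxg : x ∉ g := fun h => by simpa using hg.1 h
  rw [← erase_insert hxf, ← erase_insert hxg]
  exact congrArg (fun s => s.erase x) hfg

/-- In an `F₅`-free 3-graph, an outside vertex `b` is joined in the link of `x` to at most one
vertex of an edge `e` avoiding `x`. -/
theorem F5Free.eq_of_mem (hF5 : F5Free H) (h3 : IsThreeGraph H) {e f g : Finset (Fin n)}
    (he : e ∈ H) (hf : f ∈ H) (hg : g ∈ H) {x b : Fin n} (hxe : x ∉ e) (hbe : b ∉ e)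
    (hbx : b ≠ x) (hxf : x ∈ f) (hxg : x ∈ g) (hbf : b ∈ f) (hbg : b ∈ g)
    (hfe : ¬ Disjoint f e) (hge : ¬ Disjoint g e) : f = g := by
  obtain ⟨u, huf, hue⟩ := not_disjoint_iff.1 hfe
  obtain ⟨v, hvg, hve⟩ := not_disjoint_iff.1 hge
  have hxu : x ≠ u := by rintro rfl; exact hxe hue
  have hbu : b ≠ u := by rintro rfl; exact hbe hue
  have hxv : x ≠ v := by rintro rfl; exact hxe hve
  have hbv : b ≠ v := by rintro rfl; exact hbe hve
  have hf' := eq_triple_of_card_eq_three (h3 f hf) hxf hbf huf hbx.symm hxu hbu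
  have hg' := eq_triple_of_card_eq_three (h3 g hg) hxg hbg hvg hbx.symm hxv hbv
  by_contra hfg
  have huv : u ≠ v := by rintro rfl; exact hfg (hf'.trans hg'.symm)
  obtain ⟨w, huw, hvw, he'⟩ := exists_eq_triple_of_card_eq_three (h3 e he) hue hve huv
  have hxw : x ≠ w := by rintro rfl; exact hxe (by simp [he'])
  have hbw : b ≠ w := by rintro rfl; exact hbe (by simp [he'])
  refine hF5 ⟨x, b, u, v, w, ?_, hf' ▸ hf, hg' ▸ hg, he' ▸ he⟩
  simp [card_insert_of_notMem, *, hbx.symm]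

theorem F5Free.card_filter_mem_not_disjoint_le (hF5 : F5Free H) (h3 : IsThreeGraph H)
    {e : Finset (Fin n)} (he : e ∈ H) {x : Fin n} (hxe : x ∉ e) :
    #(H.filter fun f => x ∈ f ∧ ¬ Disjoint f e) + 1 ≤ n := by
  set S := H.filter fun f => x ∈ f ∧ ¬ Disjoint f e
  have hc : #(insert x e) = 4 := by rw [card_insert_of_notMem hxe, h3 e he]
  have h1 : #(S.filter fun f => ¬ f ⊆ insert x e) ≤ #(univ \ insert x e) := by
    refine card_le_card_of_forall_subsingleton (fun f b => b ∈ f) ?_ ?_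
    · intro f hf
      obtain ⟨b, hb, hb'⟩ := not_subset.1 (mem_filter.1 hf).2
      exact ⟨b, by simpa using hb', hb⟩
    · rintro b hb f ⟨hf, hbf⟩ g ⟨hg, hbg⟩
      simp only [S, mem_filter] at hf hg
      simp only [mem_sdiff, mem_univ, true_and, mem_insert, not_or] at hb
      exact hF5.eq_of_mem h3 he hf.1.1 hg.1.1 hxe hb.2 hb.1 hf.1.2.1 hg.1.2.1 hbf hbg
        hf.1.2.2 hg.1.2.2
  have h2 : #(S.filter fun f => f ⊆ insert x e) ≤ #e := by
    have key : ∀ v ∈ e, ∀ f ∈ S.filter (fun f => f ⊆ insert x e), v ∉ f →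
        f = (insert x e).erase v := by
      intro v hv f hf hvf
      simp only [S, mem_filter] at hf
      refine eq_of_subset_of_card_le (subset_erase.2 ⟨hf.2, hvf⟩) ?_
      rw [card_erase_of_mem (mem_insert_of_mem hv), hc, h3 f hf.1.1]
    refine card_le_card_of_forall_subsingleton (fun f v => v ∉ f) ?_ ?_
    · intro f hf
      simp only [S, mem_filter] at hf
      by_contra! h
      have := card_le_card (insert_subset hf.1.2.1 h)
      rw [hc, h3 f hf.1.1] at this
      omega
    · rintro v hv f ⟨hf, hvf⟩ g ⟨hg, hvg⟩
      rw [key v hv f hf hvf, key v hv g hg hvg]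
  have h4 : #(univ \ insert x e) + 4 = n := by
    have := card_sdiff_add_card_eq_card (subset_univ (insert x e))
    rwa [hc, card_univ, Fintype.card_fin] at this
  have := card_filter_add_card_filter_not (s := S) (fun f => f ⊆ insert x e)
  rw [h3 e he] at h2
  omega

/-- The part of the key degree bound concerning only edges `{x, u, v}` with `u, v ∈ W`. -/
theorem F5Free.card_filter_link_le (hF5 : F5Free H) (h3 : IsThreeGraph H) {x y c d : Fin n}
    {W : Finset (Fin n)} (hxy : x ≠ y) (hxW : x ∉ W) (hyW : y ∉ W) (hc : c ∈ W) (hd : d ∈ W)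
    (hcd : c ≠ d) (he : {y, c, d} ∈ H) :
    #(H.filter fun f => f \ {x, y} ⊆ W ∧ x ∈ f ∧ y ∉ f ∧ (c ∈ f ∨ d ∈ f)) ≤ #(W.erase c) := by
  have hxc : x ≠ c := by rintro rfl; exact hxW hc
  have hxd : x ≠ d := by rintro rfl; exact hxW hd
  refine card_le_card_of_forall_subsingleton (fun f b => b ∈ f ∧ (b = d → c ∈ f)) ?_ ?_
  · intro f hf
    obtain ⟨hfH, hfW, hxf, hyf, h⟩ := mem_filter.1 hf
    by_cases hcf : c ∈ f
    · obtain ⟨b, hxb, hcb, rfl⟩ := exists_eq_triple_of_card_eq_three (h3 f hfH) hxf hcf hxc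
      refine ⟨b, mem_erase.2 ⟨hcb.symm, hfW ?_⟩, by simp, by simp⟩
      simp only [mem_sdiff, mem_insert, mem_singleton] at hyf ⊢
      grind
    · obtain ⟨b, hxb, hdb, rfl⟩ := exists_eq_triple_of_card_eq_three (h3 f hfH) hxf
        (h.resolve_left hcf) hxd
      refine ⟨b, mem_erase.2 ⟨?_, hfW ?_⟩, by simp, fun hb => absurd hb.symm hdb⟩
      · rintro rfl
        simp at hcf
      · simp only [mem_sdiff, mem_insert, mem_singleton] at hyf ⊢
        grind
  · rintro b hb f ⟨hf, hbf, hbf'⟩ g ⟨hg, hbg, hbg'⟩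
    obtain ⟨hfH, hfW, hxf, hyf, hf'⟩ := mem_filter.1 hf
    obtain ⟨hgH, hgW, hxg, hyg, hg'⟩ := mem_filter.1 hg
    obtain ⟨hbc, hbW⟩ := mem_erase.1 hb
    by_cases hbd : b = d
    · subst hbd
      rw [eq_triple_of_card_eq_three (h3 f hfH) hxf hbf (hbf' rfl) hxd hxc hcd.symm,
        eq_triple_of_card_eq_three (h3 g hgH) hxg hbg (hbg' rfl) hxd hxc hcd.symm]
    · have hbx : b ≠ x := by rintro rfl; exact hxW hbW
      have hby : b ≠ y := by rintro rfl; exact hyW hbW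
      refine hF5.eq_of_mem h3 he hfH hgH (by simp [*]) (by simp [*]) hbx hxf hxg hbf hbg ?_ ?_
      · rw [not_disjoint_iff]; aesop
      · rw [not_disjoint_iff]; aesop

theorem F5Free.two_mul_card_filter_le_sq (hF5 : F5Free H) (h3 : IsThreeGraph H) {x y : Fin n}
    (hxy : x ≠ y) (W : Finset (Fin n)) (hxW : x ∉ W) (hyW : y ∉ W) :
    2 * #(H.filter fun f => f \ {x, y} ⊆ W ∧ (x ∈ f ↔ y ∉ f)) ≤ #W ^ 2 := by
  induction W using Finset.strongInduction with
  | H W ih =>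
  by_cases h : ∃ c d, c ∈ W ∧ d ∈ W ∧ c ≠ d ∧ {x, c, d} ∈ H ∧ {y, c, d} ∈ H
  · obtain ⟨c, d, hc, hd, hcd, hx, hy⟩ := h
    have hd' : d ∈ W.erase c := mem_erase.2 ⟨hcd.symm, hd⟩
    have hW := ih ((W.erase c).erase d)
      ((erase_subset _ _).trans_ssubset (erase_ssubset hc)) (by simp [hxW]) (by simp [hyW])
    have hX := hF5.card_filter_link_le h3 hxy hxW hyW hc hd hcd hy
    have hY := hF5.card_filter_link_le h3 hxy.symm hyW hxW hc hd hcd hx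
    have hsub : (H.filter fun f => f \ {x, y} ⊆ W ∧ (x ∈ f ↔ y ∉ f)) ⊆
        (H.filter fun f => f \ {x, y} ⊆ (W.erase c).erase d ∧ (x ∈ f ↔ y ∉ f)) ∪
        ((H.filter fun f => f \ {x, y} ⊆ W ∧ x ∈ f ∧ y ∉ f ∧ (c ∈ f ∨ d ∈ f)) ∪
        (H.filter fun f => f \ {y, x} ⊆ W ∧ y ∈ f ∧ x ∉ f ∧ (c ∈ f ∨ d ∈ f))) := by
      intro f hf
      rw [pair_comm y x]
      simp only [mem_union, mem_filter, subset_erase, mem_sdiff] at hf ⊢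
      tauto
    have := (card_le_card hsub).trans
      ((card_union_le _ _).trans (Nat.add_le_add_left (card_union_le _ _) _))
    have h1 := card_erase_add_one hc
    have h2 := card_erase_add_one hd'
    rw [← h2] at hX hY h1
    rw [← h1]
    nlinarith
  · push Not at h
    have hcard : #(H.filter fun f => f \ {x, y} ⊆ W ∧ (x ∈ f ↔ y ∉ f)) ≤
        #(powersetCard 2 W) := by
      have form : ∀ f ∈ H.filter (fun f => f \ {x, y} ⊆ W ∧ (x ∈ f ↔ y ∉ f)),
          ∃ c d, c ∈ W ∧ d ∈ W ∧ c ≠ d ∧ f \ {x, y} = {c, d} ∧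
            (f = {x, c, d} ∨ f = {y, c, d}) := by
        intro f hf
        obtain ⟨hfH, hfW, hfxy⟩ := mem_filter.1 hf
        by_cases hxf : x ∈ f
        · obtain ⟨c, d, hxc, hxd, hcd, rfl⟩ := exists_eq_triple_of_mem (h3 f hfH) hxf
          have hyf := hfxy.1 hxf
          simp only [mem_insert, mem_singleton, not_or] at hyf
          have : ({x, c, d} : Finset (Fin n)) \ {x, y} = {c, d} :=
            triple_sdiff_pair (by simp) hxc.symm (Ne.symm hyf.2.1) hxd.symm (Ne.symm hyf.2.2)
          rw [this] at hfW
          exact ⟨c, d, hfW (by simp), hfW (by simp), hcd, this, Or.inl rfl⟩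
        · have hyf : y ∈ f := by tauto
          obtain ⟨c, d, hyc, hyd, hcd, rfl⟩ := exists_eq_triple_of_mem (h3 f hfH) hyf
          simp only [mem_insert, mem_singleton, not_or] at hxf
          have : ({y, c, d} : Finset (Fin n)) \ {x, y} = {c, d} :=
            triple_sdiff_pair (by simp) (Ne.symm hxf.2.1) hyc.symm (Ne.symm hxf.2.2) hyd.symm
          rw [this] at hfW
          exact ⟨c, d, hfW (by simp), hfW (by simp), hcd, this, Or.inr rfl⟩
      refine card_le_card_of_injOn (fun f => f \ {x, y}) ?_ ?_
      · intro f hf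
        obtain ⟨c, d, hc, hd, hcd, hfe, -⟩ := form f hf
        simp only [hfe, mem_coe, mem_powersetCard, insert_subset_iff, singleton_subset_iff]
        exact ⟨⟨hc, hd⟩, card_pair hcd⟩
      · intro f hf g hg hfg
        simp only at hfg
        obtain ⟨c, d, hc, hd, hcd, hfe, hf'⟩ := form f hf
        obtain ⟨c', d', hc', hd', hcd', hge, hg'⟩ := form g hg
        have hfH := (mem_filter.1 hf).1
        have hgH := (mem_filter.1 hg).1
        rw [hge, hfe] at hfg
        have hset : ∀ z : Fin n, ({z, c', d'} : Finset (Fin n)) = {z, c, d} :=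
          fun z => congrArg (insert z) hfg.symm
        rw [hset, hset] at hg'
        rcases hf' with rfl | rfl <;> rcases hg' with rfl | rfl
        · rfl
        · exact absurd hgH (h c d hc hd hcd hfH)
        · exact absurd hfH (h c d hc hd hcd hgH)
        · rfl
    rw [card_powersetCard] at hcard
    rcases hm : #W with _ | m
    · rw [hm] at hcard; simpa using hcard
    · rw [hm] at hcard
      have := two_mul_choose_two m
      nlinarith

theorem F5Free.card_lt_of_forall_mem_or_mem (hF5 : F5Free H) (h3 : IsThreeGraph H) (hn : 60 ≤ n)
    {x y : Fin n} (hxy : x ≠ y) (hcov : ∀ f ∈ H, x ∈ f ∨ y ∈ f)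
    (hx : ∃ f ∈ H, x ∉ f) (hy : ∃ f ∈ H, y ∉ f) : #H < (n - 1).choose 2 := by
  by_cases h : ∃ c d, c ≠ d ∧ c ≠ x ∧ c ≠ y ∧ d ≠ x ∧ d ≠ y ∧ {x, c, d} ∈ H ∧ {y, c, d} ∈ H
  · obtain ⟨c, d, hcd, hcx, hcy, hdx, hdy, hxH, hyH⟩ := h
    set W : Finset (Fin n) := univ \ {x, y, c, d}
    have hW : #W + 4 = n := by
      have h4 : #({x, y, c, d} : Finset (Fin n)) = 4 := by
        simp [card_insert_of_notMem, *, hcx.symm, hcy.symm, hdx.symm, hdy.symm]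
      have := card_sdiff_add_card_eq_card (subset_univ ({x, y, c, d} : Finset (Fin n)))
      rwa [h4, card_univ, Fintype.card_fin] at this
    have hP := hF5.two_mul_card_filter_le_sq h3 hxy W (by simp [W]) (by simp [W])
    have hX := hF5.card_filter_mem_not_disjoint_le h3 hyH (x := x)
      (by simp [*, hcx.symm, hdx.symm])
    have hY := hF5.card_filter_mem_not_disjoint_le h3 hxH (x := y)
      (by simp [*, hxy.symm, hcy.symm, hdy.symm])
    have hsub : H ⊆ (H.filter fun f => f \ {x, y} ⊆ W ∧ (x ∈ f ↔ y ∉ f)) ∪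
        ((H.filter fun f => x ∈ f ∧ ¬ Disjoint f {y, c, d}) ∪
        (H.filter fun f => y ∈ f ∧ ¬ Disjoint f {x, c, d})) := by
      intro f hf
      have hfW : c ∉ f → d ∉ f → f \ {x, y} ⊆ W := by
        intro hc hd b hb
        simp only [W, mem_sdiff, mem_univ, true_and, mem_insert, mem_singleton] at hb ⊢
        grind
      rcases em (x ∈ f ∧ ¬ Disjoint f {y, c, d}) with hX | hX
      · exact mem_union_right _ (mem_union_left _ (mem_filter.2 ⟨hf, hX⟩))
      rcases em (y ∈ f ∧ ¬ Disjoint f {x, c, d}) with hY | hY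
      · exact mem_union_right _ (mem_union_right _ (mem_filter.2 ⟨hf, hY⟩))
      refine mem_union_left _ (mem_filter.2 ⟨hf, ?_⟩)
      simp only [disjoint_insert_right, disjoint_singleton_right, not_and_not_right] at hX hY
      rcases hcov f hf with hxf | hyf
      · exact ⟨hfW (hX hxf).2.1 (hX hxf).2.2, iff_of_true hxf (hX hxf).1⟩
      · exact ⟨hfW (hY hyf).2.1 (hY hyf).2.2, iff_of_false (hY hyf).1 (not_not.2 hyf)⟩
    have := (card_le_card hsub).trans
      ((card_union_le _ _).trans (Nat.add_le_add_left (card_union_le _ _) _))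
    obtain ⟨k, rfl⟩ : ∃ k, n = k + 4 := ⟨#W, hW.symm⟩
    have hk : #W = k := by omega
    rw [hk] at hP
    have hc := two_mul_choose_two (k + 2)
    simp only [show k + 4 - 1 = k + 2 + 1 by omega]
    nlinarith
  · push Not at h
    by_contra hlt
    have hcard : #(powersetCard 2 (univ.erase x)) ≤ #H := by
      rw [card_powersetCard, card_erase_of_mem (mem_univ _), card_univ, Fintype.card_fin]
      omega
    set φ : Finset (Fin n) → Finset (Fin n) := fun f => if x ∈ f then f.erase x else f.erase y
    have hmaps : Set.MapsTo φ (H : Set (Finset (Fin n))) (powersetCard 2 (univ.erase x)) := by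
      intro f hf
      have := hcov f hf
      have h3f := h3 f hf
      simp only [φ, mem_coe, mem_powersetCard]
      split_ifs with hxf
      · exact ⟨erase_subset_erase _ (subset_univ _), by rw [card_erase_of_mem hxf, h3f]⟩
      · refine ⟨fun b hb => mem_erase.2 ⟨?_, mem_univ _⟩, ?_⟩
        · rintro rfl; exact hxf (mem_of_mem_erase hb)
        · rw [card_erase_of_mem (this.resolve_left hxf), h3f]
    have hmix : ∀ f ∈ H, ∀ g ∈ H, x ∈ f → x ∉ g → f.erase x ≠ g.erase y := by
      intro f hf g hg hxf hxg hfg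
      have hyg := (hcov g hg).resolve_left hxg
      obtain ⟨c, d, hyc, hyd, hcd, rfl⟩ := exists_eq_triple_of_mem (h3 g hg) hyg
      have hge : ({y, c, d} : Finset (Fin n)).erase y = {c, d} := by
        rw [erase_insert]; simp [hyc, hyd]
      simp only [mem_insert, mem_singleton, not_or] at hxg
      refine h c d hcd (Ne.symm hxg.2.1) hyc.symm (Ne.symm hxg.2.2) hyd.symm ?_ hg
      rw [← hge, ← hfg, insert_erase hxf]
      exact hf
    have hinj : Set.InjOn φ (H : Set (Finset (Fin n))) := by
      intro f hf g hg hfg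
      have hf' := hcov f hf
      have hg' := hcov g hg
      simp only [φ] at hfg
      split_ifs at hfg with hxf hxg hxg
      · rw [← insert_erase hxf, hfg, insert_erase hxg]
      · exact absurd hfg (hmix f hf g hg hxf hxg)
      · exact absurd hfg.symm (hmix g hg f hf hxg hxf)
      · rw [← insert_erase (hf'.resolve_left hxf), hfg, insert_erase (hg'.resolve_left hxg)]
    have hsurj := surjOn_of_injOn_of_card_le φ hmaps hinj hcard
    have hpair : ∀ c d, c ≠ d → c ≠ x → d ≠ x → {x, c, d} ∈ H ∨ {y, c, d} ∈ H ∧ y ≠ c := by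
      intro c d hcd hc hd
      obtain ⟨f, hf, hfe⟩ := hsurj (show ({c, d} : Finset (Fin n)) ∈
        ((powersetCard 2 (univ.erase x) : Finset (Finset (Fin n))) : Set _) by
          simp [mem_powersetCard, insert_subset_iff, card_pair hcd, hc, hd])
      have hf' := hcov f hf
      simp only [φ] at hfe
      split_ifs at hfe with hxf
      · left
        rw [← hfe, insert_erase hxf]; exact hf
      · right
        refine ⟨by rw [← hfe, insert_erase (hf'.resolve_left hxf)]; exact hf, ?_⟩
        rintro rfl
        have : y ∈ f.erase y := by rw [hfe]; simp
        simp at this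
    have hprop : ∀ c d b, c ≠ d → c ≠ x → c ≠ y → d ≠ x → d ≠ y → b ≠ x → b ≠ y → b ≠ c →
        {y, c, d} ∈ H → {y, c, b} ∈ H := by
      intro c d b hcd hcx hcy hdx hdy hbx hby hbc hH
      by_cases hbd : b = d
      · rwa [hbd]
      have hyb : {x, y, b} ∈ H := (hpair y b hby.symm hxy.symm hbx).resolve_right (by simp)
      refine ((hpair c b hbc.symm hcx hbx).resolve_left ?_).1
      intro hxcb
      have := hF5.eq_of_mem h3 hH hyb hxcb (x := x) (b := b)
        (by simp [*, hcx.symm, hdx.symm]) (by simp [*]) hbx (by simp) (by simp) (by simp)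
        (by simp) (by simp) (by simp)
      have hy' : y ∈ ({x, c, b} : Finset (Fin n)) := by rw [← this]; simp
      simp [hxy.symm, hcy.symm, hby.symm] at hy'
    obtain ⟨f, hf, hxf⟩ := hx
    obtain ⟨g, hg, hyg⟩ := hy
    have hyf := (hcov f hf).resolve_left hxf
    have hxg := (hcov g hg).resolve_right hyg
    obtain ⟨c, d, hyc, hyd, hcd, rfl⟩ := exists_eq_triple_of_mem (h3 f hf) hyf
    obtain ⟨u, v, hxu, hxv, huv, rfl⟩ := exists_eq_triple_of_mem (h3 g hg) hxg
    simp only [mem_insert, mem_singleton, not_or] at hxf hyg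
    obtain ⟨-, hxc, hxd⟩ := hxf
    obtain ⟨-, hyu, hyv⟩ := hyg
    have hyuv : {y, u, v} ∈ H := by
      by_cases huc : u = c
      · subst huc
        exact hprop u d v hcd hxu.symm (Ne.symm hyu) (Ne.symm hxd) hyd.symm hxv.symm
          (Ne.symm hyv) huv.symm hf
      · have h1 := hprop c d u hcd (Ne.symm hxc) hyc.symm (Ne.symm hxd) hyd.symm hxu.symm
          (Ne.symm hyu) huc hf
        rw [pair_comm c u] at h1
        exact hprop u c v huc hxu.symm (Ne.symm hyu) (Ne.symm hxc) hyc.symm hxv.symm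
          (Ne.symm hyv) huv.symm h1
    exact h u v huv hxu.symm (Ne.symm hyu) hxv.symm (Ne.symm hyv) hg hyuv

theorem MatchingNumLE.not_pairwise_disjoint (hν : MatchingNumLE H 2) (h3 : IsThreeGraph H)
    {e f g : Finset (Fin n)} (he : e ∈ H) (hf : f ∈ H) (hg : g ∈ H) (hef : Disjoint e f)
    (heg : Disjoint e g) (hfg : Disjoint f g) : False := by
  have hne : ∀ {a b : Finset (Fin n)}, a ∈ H → Disjoint a b → a ≠ b := by
    rintro a b ha hab rfl
    have := h3 a ha
    simp [disjoint_self.1 hab] at this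
  have := hν {e, f, g} (by simp [insert_subset_iff, he, hf, hg]) (by
    simp only [mem_insert, mem_singleton]
    rintro a (rfl | rfl | rfl) b (rfl | rfl | rfl) hab <;>
      first | exact absurd rfl hab | assumption | (apply Disjoint.symm; assumption))
  rw [card_eq_three.2 ⟨e, f, g, hne he hef, hne he heg, hne hf hfg, rfl⟩] at this
  omega

theorem card_le_mul_of_forall_not_disjoint {F : Finset (Finset (Fin n))} {T : Finset (Fin n)}
    {k : ℕ} (hT : ∀ f ∈ F, ¬ Disjoint f T) (hk : ∀ v ∈ T, #(F.filter fun f => v ∈ f) ≤ k) :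
    #F ≤ #T * k := by
  have hsub : F ⊆ T.biUnion fun v => F.filter fun f => v ∈ f := by
    intro f hf
    obtain ⟨v, hvf, hvT⟩ := not_disjoint_iff.1 (hT f hf)
    exact mem_biUnion.2 ⟨v, hvT, mem_filter.2 ⟨hf, hvf⟩⟩
  exact (card_le_card hsub).trans (card_biUnion_le_card_mul _ _ _ hk)

theorem MatchingNumLE.exists_lt_card_filter_mem (hν : MatchingNumLE H 2) (h3 : IsThreeGraph H)
    {k : ℕ} (hk : 6 * k < #H) : ∃ x, k < #(H.filter fun f => x ∈ f) := by
  by_contra! h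
  obtain ⟨e, he⟩ : H.Nonempty := card_pos.1 (by omega)
  obtain ⟨T, hTc, hT⟩ : ∃ T : Finset (Fin n), #T ≤ 6 ∧ ∀ f ∈ H, ¬ Disjoint f T := by
    by_cases hint : ∀ f ∈ H, ¬ Disjoint f e
    · exact ⟨e, by rw [h3 e he]; omega, hint⟩
    · push Not at hint
      obtain ⟨f, hf, hfe⟩ := hint
      refine ⟨e ∪ f, (card_union_le _ _).trans (by rw [h3 e he, h3 f hf]), fun g hg hd => ?_⟩
      rw [disjoint_union_right] at hd
      exact hν.not_pairwise_disjoint h3 hg he hf hd.1 hd.2 hfe.symm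
  have := card_le_mul_of_forall_not_disjoint hT (fun v _ => h v)
  have := Nat.mul_le_mul_right k hTc
  omega

theorem F5Free.card_filter_mem_le (hF5 : F5Free H) (h3 : IsThreeGraph H)
    {e : Finset (Fin n)} (he : e ∈ H) {x : Fin n} (hxe : x ∉ e) :
    #(H.filter fun f => x ∈ f) + 1 ≤ n + (n - 4).choose 2 := by
  have h1 := hF5.card_filter_mem_not_disjoint_le h3 he hxe
  have h2 : #(H.filter fun f => x ∈ f ∧ Disjoint f e) ≤
      #(powersetCard 2 (univ \ insert x e)) := by
    refine card_le_card_of_injOn (fun f => f.erase x) ?_ ?_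
    · intro f hf
      obtain ⟨hfH, hxf, hd⟩ := mem_filter.1 hf
      simp only [mem_coe, mem_powersetCard, card_erase_of_mem hxf, h3 f hfH, and_true]
      intro b hb
      have := disjoint_left.1 hd (mem_of_mem_erase hb)
      simp [ne_of_mem_erase hb, this]
    · intro f hf g hg hfg
      simp only at hfg
      rw [← insert_erase (mem_filter.1 hf).2.1, hfg, insert_erase (mem_filter.1 hg).2.1]
  have hc : #(univ \ insert x e) = n - 4 := by
    rw [card_sdiff_of_subset (subset_univ _), card_insert_of_notMem hxe, h3 e he, card_univ,
      Fintype.card_fin]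
  rw [card_powersetCard, hc] at h2
  have hsub : (H.filter fun f => x ∈ f) ⊆ (H.filter fun f => x ∈ f ∧ Disjoint f e) ∪
      (H.filter fun f => x ∈ f ∧ ¬ Disjoint f e) := by
    intro f hf
    simp only [mem_union, mem_filter] at hf ⊢
    tauto
  have := (card_le_card hsub).trans (card_union_le _ _)
  omega

/-- An intersecting `F₅`-free 3-graph without a common vertex has fewer than `2n - 8` edges. -/
theorem F5Free.card_lt_of_intersecting (hF5 : F5Free H) (h3 : IsThreeGraph H) (hn : 60 ≤ n)
    (hint : ∀ e ∈ H, ∀ f ∈ H, ¬ Disjoint e f) (hstar : ∀ y, ∃ e ∈ H, y ∉ e) :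
    #H + 8 < 2 * n := by
  by_cases h : ∃ p q, p ≠ q ∧ 7 ≤ #(H.filter fun f => p ∈ f ∧ q ∈ f)
  · obtain ⟨p, q, hpq, h7⟩ := h
    have hdeg : ∀ y, #(H.filter fun f => y ∈ f) + 1 ≤ n := by
      intro y
      obtain ⟨e, he, hye⟩ := hstar y
      refine le_trans ?_ (hF5.card_filter_mem_not_disjoint_le h3 he hye)
      gcongr with f hf
      exact fun hy => ⟨hy, hint f hf e he⟩
    have hcov : ∀ f ∈ H, p ∈ f ∨ q ∈ f := by
      intro f hf
      by_contra! hpqf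
      have : #(H.filter fun g => p ∈ g ∧ q ∈ g) ≤ #f := by
        refine card_le_card_of_forall_subsingleton (fun g v => v ∈ g) ?_ ?_
        · intro g hg
          obtain ⟨v, hvf, hvg⟩ := not_disjoint_iff.1 (hint f hf g (mem_filter.1 hg).1)
          exact ⟨v, hvf, hvg⟩
        · rintro v hv g ⟨hg, hvg⟩ g' ⟨hg', hvg'⟩
          obtain ⟨hgH, hpg, hqg⟩ := mem_filter.1 hg
          obtain ⟨hgH', hpg', hqg'⟩ := mem_filter.1 hg'
          have hpv : p ≠ v := by rintro rfl; exact hpqf.1 hv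
          have hqv : q ≠ v := by rintro rfl; exact hpqf.2 hv
          rw [eq_triple_of_card_eq_three (h3 g hgH) hpg hqg hvg hpq hpv hqv,
            eq_triple_of_card_eq_three (h3 g' hgH') hpg' hqg' hvg' hpq hpv hqv]
      rw [h3 f hf] at this
      omega
    have hH : (H.filter fun f => p ∈ f) ∪ (H.filter fun f => q ∈ f) = H := by
      rw [← filter_or, filter_true_of_mem hcov]
    have := card_union_add_card_inter (H.filter fun f => p ∈ f) (H.filter fun f => q ∈ f)
    rw [hH, ← filter_and] at this
    have := hdeg p
    have := hdeg q
    omega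
  · push Not at h
    have hdeg : ∀ y, #(H.filter fun f => y ∈ f) ≤ 18 := by
      intro y
      obtain ⟨e, he, hye⟩ := hstar y
      have := card_le_mul_of_forall_not_disjoint (F := H.filter fun f => y ∈ f) (T := e) (k := 6)
        (fun f hf => hint f (mem_filter.1 hf).1 e he) (fun v hv => by
          have := h y v (by rintro rfl; exact hye hv)
          rw [filter_filter]
          omega)
      rw [h3 e he] at this
      omega
    obtain ⟨e, he, -⟩ := hstar ⟨0, by omega⟩
    have := card_le_mul_of_forall_not_disjoint (fun f hf => hint f hf e he) (fun v _ => hdeg v)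
    rw [h3 e he] at this
    omega

theorem F5Free.mono {F : Finset (Finset (Fin n))} (hF5 : F5Free H) (h : F ⊆ H) : F5Free F :=
  fun ⟨a, b, c, d, e, h5, h1, h2, h3⟩ => hF5 ⟨a, b, c, d, e, h5, h h1, h h2, h h3⟩

theorem F5Free.card_lt_choose (hF5 : F5Free H) (h3 : IsThreeGraph H) (hν : MatchingNumLE H 2)
    (hn : 60 ≤ n) (hstar : ∀ x, ∃ e ∈ H, x ∉ e) : #H < (n - 1).choose 2 := by
  by_cases hbig : 6 * (2 * n) < #H
  swap
  · obtain ⟨k, rfl⟩ : ∃ k, n = k + 2 := ⟨n - 2, by omega⟩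
    have := two_mul_choose_two k
    simp only [show k + 2 - 1 = k + 1 by omega]
    nlinarith
  obtain ⟨x, hx⟩ := hν.exists_lt_card_filter_mem h3 hbig
  set F := H.filter fun f => x ∉ f with hF
  have hFH : F ⊆ H := filter_subset _ _
  have hint : ∀ e ∈ F, ∀ f ∈ F, ¬ Disjoint e f := by
    intro e he f hf hef
    obtain ⟨heH, hxe⟩ := mem_filter.1 he
    obtain ⟨hfH, hxf⟩ := mem_filter.1 hf
    have h1 := hF5.card_filter_mem_not_disjoint_le h3 heH hxe
    have h2 := hF5.card_filter_mem_not_disjoint_le h3 hfH hxf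
    have hsub : (H.filter fun f => x ∈ f) ⊆ (H.filter fun g => x ∈ g ∧ ¬ Disjoint g e) ∪
        (H.filter fun g => x ∈ g ∧ ¬ Disjoint g f) := by
      intro g hg
      obtain ⟨hgH, hxg⟩ := mem_filter.1 hg
      simp only [mem_union, mem_filter, hgH, hxg, true_and]
      by_contra! hd
      exact hν.not_pairwise_disjoint h3 hgH heH hfH hd.1 hd.2 hef
    have := (card_le_card hsub).trans (card_union_le _ _)
    omega
  obtain ⟨e, he, hxe⟩ := hstar x
  by_cases hy : ∃ y, ∀ f ∈ F, y ∈ f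
  · obtain ⟨y, hy⟩ := hy
    have hye := hy e (mem_filter.2 ⟨he, hxe⟩)
    refine hF5.card_lt_of_forall_mem_or_mem h3 hn (x := x) (y := y) ?_ ?_ (hstar x) (hstar y)
    · rintro rfl; exact hxe hye
    · intro f hf
      by_cases hxf : x ∈ f
      · exact Or.inl hxf
      · exact Or.inr (hy f (mem_filter.2 ⟨hf, hxf⟩))
  · push Not at hy
    have h1 := (hF5.mono hFH).card_lt_of_intersecting (fun f hf => h3 f (hFH hf)) hn hint hy
    have h2 := hF5.card_filter_mem_le h3 he hxe
    have h4 := card_filter_add_card_filter_not (s := H) (fun f => x ∈ f)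
    obtain ⟨k, rfl⟩ : ∃ k, n = k + 5 := ⟨n - 5, by omega⟩
    have h5 := two_mul_choose_two k
    have h6 := two_mul_choose_two (k + 3)
    simp only [show k + 5 - 1 = k + 3 + 1 by omega, show k + 5 - 4 = k + 1 by omega] at *
    nlinarith

end

theorem ex3_F5_matching_small_s (n s : ℕ) (hs : s = 1 ∨ s = 2) (hn : 60 ≤ n)
    (H : Finset (Finset (Fin n))) (h3 : IsThreeGraph H) (hF5 : F5Free H)
    (hν : MatchingNumLE H s) :
    H.card ≤ (n - 1).choose 2 ∧
      (H.card = (n - 1).choose 2 ↔ ∃ x : Fin n, H = fullStar n x) := by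
  have hν2 : MatchingNumLE H 2 := fun M hM hd => (hν M hM hd).trans (by omega)
  by_cases hstar : ∃ x, ∀ e ∈ H, x ∈ e
  · obtain ⟨x, hx⟩ := hstar
    have hsub : H ⊆ fullStar n x := fun e he =>
      mem_filter.2 ⟨mem_powersetCard.2 ⟨subset_univ _, h3 e he⟩, hx e he⟩
    have hle := card_le_card hsub
    rw [card_fullStar] at hle
    refine ⟨hle, fun h => ⟨x, eq_of_subset_of_card_le hsub ?_⟩, ?_⟩
    · rw [card_fullStar, h]
    · rintro ⟨y, rfl⟩
      exact card_fullStar y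
  · push Not at hstar
    have hlt := hF5.card_lt_choose h3 hν2 hn hstar
    refine ⟨hlt.le, fun h => absurd h hlt.ne, ?_⟩
    rintro ⟨y, rfl⟩
    exact card_fullStar y
end

section
/- Let p ≥ 2 and let G_1,…,G_p be graphs on vertex set [n] that are 2-colored triangle free. Then the sum of their numbers of edges satisfies Σ_{i=1}^{p} e(G_i) ≤ p·⌊n²/4⌋. -/
open Finset

/-- Graphs `G 1, …, G p` (edges of `G i` colored `i`) are 2-colored triangle free:
there are no vertices `x, y, z` and distinct colors `i ≠ j` with
`xy, xz ∈ E(G i)` and `yz ∈ E(G j)`. -/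
def TwoColoredTriangleFree {n p : ℕ} (G : Fin p → SimpleGraph (Fin n)) : Prop :=
  ¬ ∃ (i j : Fin p) (x y z : Fin n),
      i ≠ j ∧ (G i).Adj x y ∧ (G i).Adj x z ∧ (G j).Adj y z

/-- A symmetric weight with values in `{0, 1, 2}`, vanishing on the diagonal, such that every
vertex sends total weight at most `2` to the ends of a pair of weight `2`, has total weight at most
`4 * (s ^ 2 / 4)` over the ordered pairs from a set of size `s`. -/
theorem sum_weight_le_of_heavy_pair {V : Type*} [DecidableEq V] (w : V → V → ℕ)
    (symm : ∀ x y, w x y = w y x) (diag : ∀ x, w x x = 0) (le_two : ∀ x y, w x y ≤ 2)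
    (heavy : ∀ x y, w x y = 2 → ∀ z, w x z + w y z ≤ 2) (S : Finset V) :
    ∑ x ∈ S, ∑ y ∈ S, w x y ≤ 4 * (S.card ^ 2 / 4) := by
  induction S using Finset.strongInduction with
  | H S ih =>
    by_cases hS : ∃ x ∈ S, ∃ y ∈ S, w x y = 2
    · obtain ⟨x, hx, y, hy, hxy⟩ := hS
      have hne : x ≠ y := by
        rintro rfl
        simp [diag] at hxy
      obtain ⟨T, hyT, hxT, rfl⟩ : ∃ T : Finset V, y ∉ T ∧ x ∉ insert y T ∧
          S = insert x (insert y T) := by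
        refine ⟨(S.erase x).erase y, by simp, by simp [hne], ?_⟩
        rw [insert_erase (mem_erase.2 ⟨hne.symm, hy⟩), insert_erase hx]
      have hT := ih T ((ssubset_insert hyT).trans (ssubset_insert hxT))
      have hcross : ∑ z ∈ T, (w x z + w y z) ≤ T.card * 2 :=
        sum_le_card_nsmul _ _ _ fun z _ => heavy x y hxy z
      rw [sum_add_distrib] at hcross
      have hsq : (T.card + 1 + 1) ^ 2 / 4 = T.card ^ 2 / 4 + T.card + 1 := by
        rw [show (T.card + 1 + 1) ^ 2 = T.card ^ 2 + (T.card + 1) * 4 by ring,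
          Nat.add_mul_div_right _ _ (by norm_num)]
        ring
      rw [card_insert_of_notMem hxT, card_insert_of_notMem hyT, hsq]
      have hcol : ∀ z, ∑ v ∈ T, w v z = ∑ v ∈ T, w z v := fun z =>
        sum_congr rfl fun v _ => symm v z
      simp only [sum_insert hxT, sum_insert hyT, sum_add_distrib, diag, hcol]
      have hyx := symm y x
      omega
    · push Not at hS
      have hrow : ∀ x ∈ S, ∑ y ∈ S, w x y ≤ S.card - 1 := by
        intro x hx
        rw [← add_sum_erase S _ hx, diag, zero_add, ← card_erase_of_mem hx]
        refine (sum_le_card_nsmul _ _ 1 fun y hy => ?_).trans (by simp)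
        have h₁ := hS x hx y (mem_of_mem_erase hy)
        have h₂ := le_two x y
        omega
      refine (sum_le_card_nsmul _ _ _ hrow).trans ?_
      rw [smul_eq_mul]
      obtain ⟨k, hk | hk⟩ := Nat.even_or_odd' S.card
      · rw [hk, show (2 * k) ^ 2 = k ^ 2 * 4 by ring, Nat.mul_div_cancel _ (by norm_num)]
        calc 2 * k * (2 * k - 1) ≤ 2 * k * (2 * k) := Nat.mul_le_mul_left _ (Nat.sub_le _ _)
          _ = 4 * k ^ 2 := by ring
      · rw [hk, show (2 * k + 1) ^ 2 = 1 + (k ^ 2 + k) * 4 by ring,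
          Nat.add_mul_div_right _ _ (by norm_num), Nat.add_sub_cancel]
        rw [Nat.div_eq_of_lt (by norm_num : 1 < 4)]
        nlinarith

theorem SimpleGraph.sum_sum_adj_eq_two_mul_card_edgeFinset {V : Type*} [Fintype V]
    (G : SimpleGraph V) [DecidableRel G.Adj] :
    ∑ x, ∑ y, (if G.Adj x y then 1 else 0) = 2 * G.edgeFinset.card := by
  rw [← G.sum_degrees_eq_twice_card_edges]
  refine sum_congr rfl fun x _ => ?_
  rw [← G.card_neighborFinset_eq_degree, G.neighborFinset_eq_filter, card_filter]

theorem TwoColoredTriangleFree.card_edgeFinset_add_le {n p : ℕ} {G : Fin p → SimpleGraph (Fin n)}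
    [∀ i, DecidableRel (G i).Adj] (h : TwoColoredTriangleFree G) {i j : Fin p} (hij : i ≠ j) :
    (G i).edgeFinset.card + (G j).edgeFinset.card ≤ 2 * (n ^ 2 / 4) := by
  have key := sum_weight_le_of_heavy_pair
    (fun x y => (if (G i).Adj x y then 1 else 0) + (if (G j).Adj x y then 1 else 0))
    (fun x y => by simp only [SimpleGraph.adj_comm]) (by simp)
    (fun x y => by split_ifs <;> simp)
    (fun x y hxy z => by
      have hi : (G i).Adj x y := by
        by_contra hc
        simp only [hc] at hxy
        split_ifs at hxy <;> simp_all
      have hj : (G j).Adj x y := by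
        by_contra hc
        simp only [hc] at hxy
        split_ifs at hxy <;> simp_all
      have h₁ : ¬ ((G i).Adj x z ∧ (G i).Adj y z) := fun ⟨a, b⟩ =>
        h ⟨i, j, z, x, y, hij, a.symm, b.symm, hj⟩
      have h₂ : ¬ ((G j).Adj x z ∧ (G j).Adj y z) := fun ⟨a, b⟩ =>
        h ⟨j, i, z, x, y, hij.symm, a.symm, b.symm, hi⟩
      split_ifs <;> simp_all)
    univ
  simp only [sum_add_distrib, SimpleGraph.sum_sum_adj_eq_two_mul_card_edgeFinset, card_univ,
    Fintype.card_fin] at key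
  omega

theorem two_colored_mantel (n p : ℕ) (hp : 2 ≤ p) (G : Fin p → SimpleGraph (Fin n))
    [∀ i, DecidableRel (G i).Adj] (h : TwoColoredTriangleFree G) :
    ∑ i, (G i).edgeFinset.card ≤ p * (n ^ 2 / 4) := by
  obtain ⟨k, rfl⟩ := Nat.exists_eq_add_of_le' hp
  have hsum : ∑ i, ((G i).edgeFinset.card + (G (i + 1)).edgeFinset.card) ≤
      (k + 2) * (2 * (n ^ 2 / 4)) := by
    refine (sum_le_card_nsmul univ _ (2 * (n ^ 2 / 4)) fun i _ => ?_).trans (by simp)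
    exact h.card_edgeFinset_add_le (by simp)
  have hshift : ∑ i, (G (i + 1)).edgeFinset.card = ∑ i, (G i).edgeFinset.card :=
    Equiv.sum_comp (Equiv.addRight (1 : Fin (k + 2))) fun i => (G i).edgeFinset.card
  rw [sum_add_distrib, hshift] at hsum
  linarith
end

section
/- Let p ≥ 2 and let G_1,…,G_p be graphs on vertex set [n] that are 2-colored triangle free. Then Σ_{i=1}^{p} e(G_i) = p·⌊n²/4⌋ holds if and only if G_1 = G_2 = ⋯ = G_p and this common graph is a complete bipartite graph K_{⌊n/2⌋,⌈n/2⌉}, i.e., there is a partition of [n] into parts of sizes ⌊n/2⌋ and ⌈n/2⌉ such that every G_i consists of all pairs meeting both parts. -/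
open Finset

/-- Splitting two distinct vertices off a symmetric weight with zero diagonal. -/
lemma sum_sum_insert_insert {V : Type*} [DecidableEq V] {w : V → V → ℕ}
    (hsymm : ∀ x y, w x y = w y x) (hdiag : ∀ x, w x x = 0) {u v : V} {T : Finset V}
    (huv : u ≠ v) (hu : u ∉ T) (hv : v ∉ T) :
    ∑ x ∈ insert u (insert v T), ∑ y ∈ insert u (insert v T), w x y =
      ∑ x ∈ T, ∑ y ∈ T, w x y + 2 * ∑ z ∈ T, (w u z + w v z) + 2 * w u v := by
  have hu' : u ∉ insert v T := by simp [huv, hu]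
  simp only [sum_insert hu', sum_insert hv, sum_add_distrib, hdiag]
  rw [sum_congr rfl fun x _ => hsymm x u, sum_congr rfl fun x _ => hsymm x v, hsymm v u]
  ring

lemma add_two_sq_div_four (t : ℕ) : (t + 2) ^ 2 / 4 = t ^ 2 / 4 + t + 1 := by
  rw [show (t + 2) ^ 2 = t ^ 2 + (t + 1) * 4 by ring, Nat.add_mul_div_right _ _ (by norm_num)]
  ring

/-- A weighted form of Mantel's bound. -/
lemma sum_sum_weight_le {V : Type*} [DecidableEq V] {w : V → V → ℕ} {p : ℕ}
    (hsymm : ∀ x y, w x y = w y x) (hdiag : ∀ x, w x x = 0) (hle : ∀ x y, w x y ≤ p)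
    (hadd : ∀ u v z, 0 < w u v → w u z + w v z ≤ p) (S : Finset V) :
    ∑ x ∈ S, ∑ y ∈ S, w x y ≤ 2 * (p * (#S ^ 2 / 4)) := by
  induction S using Finset.strongInduction with
  | H S ih =>
    by_cases hz : ∀ x ∈ S, ∀ y ∈ S, w x y = 0
    · rw [sum_eq_zero fun x hx => sum_eq_zero (hz x hx)]
      exact Nat.zero_le _
    push Not at hz
    obtain ⟨u, hu, v, hv, huv⟩ := hz
    have hne : u ≠ v := by rintro rfl; exact huv (hdiag u)
    have hS : insert u (insert v ((S.erase u).erase v)) = S := by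
      rw [insert_erase (by simp [hv, hne.symm]), insert_erase hu]
    set T := (S.erase u).erase v with hT
    have huT : u ∉ T := by simp [hT]
    have hvT : v ∉ T := by simp [hT]
    have hTS : T ⊂ S := ((erase_subset _ _).trans_ssubset (erase_ssubset hu))
    have hcard : #S = #T + 2 := by
      rw [← hS, card_insert_of_notMem (by simp [hne, huT]), card_insert_of_notMem hvT]
    have h₁ := ih T hTS
    have h₂ := T.sum_le_card_nsmul _ p fun z _ => hadd u v z (Nat.pos_of_ne_zero huv)
    have h₃ := hle u v
    rw [hcard, add_two_sq_div_four, ← hS, sum_sum_insert_insert hsymm hdiag hne huT hvT]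
    simp only [smul_eq_mul] at h₂
    nlinarith

/-- Equality in `sum_sum_weight_le` forces tightness at each pair of positive weight. -/
lemma weight_eq_of_sum_sum_eq {V : Type*} [Fintype V] [DecidableEq V] {w : V → V → ℕ} {p : ℕ}
    (hsymm : ∀ x y, w x y = w y x) (hdiag : ∀ x, w x x = 0) (hle : ∀ x y, w x y ≤ p)
    (hadd : ∀ u v z, 0 < w u v → w u z + w v z ≤ p)
    (heq : ∑ x, ∑ y, w x y = 2 * (p * (Fintype.card V ^ 2 / 4))) {u v : V} (huv : 0 < w u v) :
    w u v = p ∧ ∀ z, w u z + w v z = p := by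
  have hne : u ≠ v := by rintro rfl; exact huv.ne' (hdiag u)
  have hS : insert u (insert v ((univ.erase u).erase v)) = univ := by
    rw [insert_erase (by simp [hne.symm]), insert_erase (mem_univ u)]
  set T := (univ.erase u).erase v with hT
  have huT : u ∉ T := by simp [hT]
  have hvT : v ∉ T := by simp [hT]
  have hcard : Fintype.card V = #T + 2 := by
    rw [← card_univ, ← hS, card_insert_of_notMem (by simp [hne, huT]), card_insert_of_notMem hvT]
  have h₁ := sum_sum_weight_le hsymm hdiag hle hadd T
  have h₂ : ∑ z ∈ T, (w u z + w v z) ≤ ∑ _z ∈ T, p := sum_le_sum fun z _ => hadd u v z huv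
  have h₃ := hle u v
  rw [hcard, add_two_sq_div_four, ← hS, sum_sum_insert_insert hsymm hdiag hne huT hvT] at heq
  have hc : ∑ _z ∈ T, p = #T * p := by simp
  have hw : w u v = p := by nlinarith
  have hsum : ∑ z ∈ T, (w u z + w v z) = ∑ _z ∈ T, p := by nlinarith
  refine ⟨hw, fun z => ?_⟩
  by_cases hzT : z ∈ T
  · exact (sum_eq_sum_iff_of_le fun z _ => hadd u v z huv).1 hsum z hzT
  · have : z = u ∨ z = v := by
      by_contra! hz
      exact hzT (by simp [hT, hz.1, hz.2])
    rcases this with rfl | rfl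
    · rw [hdiag, hsymm, hw, zero_add]
    · rw [hdiag, hw, add_zero]

lemma card_edgeFinset_of_adj_iff {V : Type*} [Fintype V] [DecidableEq V] (G : SimpleGraph V)
    [DecidableRel G.Adj] {P Q : Finset V} (hPQ : Disjoint P Q)
    (hG : ∀ x y, G.Adj x y ↔ (x ∈ P ∧ y ∈ Q) ∨ (x ∈ Q ∧ y ∈ P)) :
    #G.edgeFinset = #P * #Q := by
  have hb : G.IsBipartiteWith (P : Set V) Q :=
    ⟨by exact_mod_cast hPQ, fun x y hxy => by simpa using (hG x y).1 hxy⟩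
  rw [← SimpleGraph.isBipartiteWith_sum_degrees_eq_card_edges hb, ← smul_eq_mul]
  refine sum_eq_card_nsmul fun x hx => ?_
  rw [← SimpleGraph.card_neighborFinset_eq_degree]
  congr 1
  ext y
  have := disjoint_left.1 hPQ hx
  simp [hG, hx, this]

lemma half_mul_half_succ (n : ℕ) : n / 2 * ((n + 1) / 2) = n ^ 2 / 4 := by
  induction n using Nat.twoStepInduction with
  | zero => rfl
  | one => rfl
  | more n ih _ =>
    rw [add_two_sq_div_four, ← ih, show (n + 2) / 2 = n / 2 + 1 by omega,
      show (n + 2 + 1) / 2 = (n + 1) / 2 + 1 by omega]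
    have : n / 2 + (n + 1) / 2 = n := by omega
    nlinarith

lemma halves_of_mul_eq {a b n : ℕ} (hab : a ≤ b) (hn : a + b = n) (h : a * b = n ^ 2 / 4) :
    a = n / 2 ∧ b = (n + 1) / 2 := by
  obtain ⟨d, rfl⟩ := Nat.exists_eq_add_of_le hab
  subst hn
  rw [show (a + (a + d)) ^ 2 = d ^ 2 + a * (a + d) * 4 by ring,
    Nat.add_mul_div_right _ _ (by norm_num)] at h
  have hd : d < 2 := by
    by_contra! hd
    have : 4 ≤ d ^ 2 := by nlinarith
    omega
  omega

/-- A graph in which each edge `uv` splits the vertices into neighbours of `u` and of `v` is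
complete bipartite as soon as it has an edge. -/
lemma adj_iff_of_adj_xor {V : Type*} {H : V → V → Prop} (hsymm : ∀ x y, H x y → H y x)
    (hxor : ∀ u v, H u v → ∀ z, H u z ↔ ¬ H v z) {u v : V} (huv : H u v) (x y : V) :
    H x y ↔ (H u x ∧ H v y) ∨ (H v x ∧ H u y) := by
  have h₁ := hxor u v huv x
  have h₂ := hxor u v huv y
  constructor
  · intro hxy
    have h₃ := hxor x y hxy u
    have h₄ := hsymm u x
    have h₅ := hsymm u y
    have h₆ := hsymm x u
    have h₇ := hsymm y u
    tauto
  · rintro (⟨hx, hy⟩ | ⟨hx, hy⟩)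
    · exact (hxor u x hx y).not_left.1 (by tauto)
    · exact (hxor v x hx y).not_left.1 (by tauto)

/-- The number of colors of the pair `x`, `y`. -/
def colorCount {V : Type*} {p : ℕ} (G : Fin p → SimpleGraph V)
    [∀ i, DecidableRel (G i).Adj] (x y : V) : ℕ :=
  #{i | (G i).Adj x y}

section colorCount

variable {V : Type*} {p : ℕ} (G : Fin p → SimpleGraph V) [∀ i, DecidableRel (G i).Adj]

lemma colorCount_comm (x y : V) : colorCount G x y = colorCount G y x := by
  simp only [colorCount, SimpleGraph.adj_comm _ x y]

lemma colorCount_self (x : V) : colorCount G x x = 0 := by simp [colorCount]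

lemma colorCount_le (x y : V) : colorCount G x y ≤ p := by
  simpa [colorCount] using card_le_univ ({i | (G i).Adj x y} : Finset (Fin p))

lemma colorCount_pos {x y : V} : 0 < colorCount G x y ↔ ∃ i, (G i).Adj x y := by
  simp [colorCount, card_pos, Finset.Nonempty]

lemma colorCount_eq_iff {x y : V} : colorCount G x y = p ↔ ∀ i, (G i).Adj x y := by
  have := card_eq_iff_eq_univ ({i | (G i).Adj x y} : Finset (Fin p))
  rw [Fintype.card_fin] at this
  simp [colorCount, this, Finset.ext_iff]

lemma sum_sum_colorCount [Fintype V] [DecidableEq V] :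
    ∑ x, ∑ y, colorCount G x y = 2 * ∑ i, #(G i).edgeFinset := by
  simp only [mul_sum, ← SimpleGraph.sum_degrees_eq_twice_card_edges]
  rw [sum_comm (s := (univ : Finset (Fin p)))]
  refine sum_congr rfl fun x _ => ?_
  simp only [colorCount, card_filter, ← SimpleGraph.card_neighborFinset_eq_degree,
    SimpleGraph.neighborFinset_eq_filter]
  exact sum_comm

end colorCount

namespace TwoColoredTriangleFree

variable {n p : ℕ} {G : Fin p → SimpleGraph (Fin n)}

lemma eq_of_adj (h : TwoColoredTriangleFree G) {i j : Fin p} {x y z : Fin n}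
    (hxy : (G i).Adj x y) (hxz : (G i).Adj x z) (hyz : (G j).Adj y z) : i = j := by
  by_contra hij
  exact h ⟨i, j, x, y, z, hij, hxy, hxz, hyz⟩

variable [∀ i, DecidableRel (G i).Adj]

lemma colorCount_add_le (h : TwoColoredTriangleFree G) (hp : 2 ≤ p) (u v z : Fin n)
    (huv : 0 < colorCount G u v) : colorCount G u z + colorCount G v z ≤ p := by
  by_cases hd : Disjoint (univ.filter fun i => (G i).Adj u z) (univ.filter fun i => (G i).Adj v z)
  · rw [colorCount, colorCount, ← card_union_of_disjoint hd]
    simpa using card_le_univ ((univ.filter fun i => (G i).Adj u z) ∪ univ.filter fun i => (G i).Adj v z)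
  · obtain ⟨i, hi, hi'⟩ := not_disjoint_iff.1 hd
    obtain ⟨k, hk⟩ := (colorCount_pos G).1 huv
    simp only [mem_filter, mem_univ, true_and] at hi hi'
    obtain rfl := h.eq_of_adj hi.symm hi'.symm hk
    have : Nonempty (Fin p) := ⟨i⟩
    have h₁ : colorCount G u z ≤ 1 := card_le_one_iff_subset_singleton.2
      ⟨i, fun j hj => by
        simp only [mem_filter, mem_univ, true_and] at hj
        simpa using (h.eq_of_adj hk.symm hi' hj).symm⟩
    have h₂ : colorCount G v z ≤ 1 := card_le_one_iff_subset_singleton.2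
      ⟨i, fun j hj => by
        simp only [mem_filter, mem_univ, true_and] at hj
        simpa using (h.eq_of_adj hk hi hj).symm⟩
    omega

lemma colorCount_eq_of_sum_eq (h : TwoColoredTriangleFree G) (hp : 2 ≤ p)
    (heq : ∑ i, #(G i).edgeFinset = p * (n ^ 2 / 4)) {u v : Fin n}
    (huv : 0 < colorCount G u v) :
    colorCount G u v = p ∧ ∀ z, colorCount G u z + colorCount G v z = p :=
  weight_eq_of_sum_sum_eq (colorCount_comm G) (colorCount_self G) (colorCount_le G)
    (h.colorCount_add_le hp) (by rw [sum_sum_colorCount, heq, Fintype.card_fin]) huv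

end TwoColoredTriangleFree

theorem two_colored_mantel_equality (n p : ℕ) (hp : 2 ≤ p)
    (G : Fin p → SimpleGraph (Fin n)) [∀ i, DecidableRel (G i).Adj]
    (h : TwoColoredTriangleFree G) :
    (∑ i, (G i).edgeFinset.card = p * (n ^ 2 / 4)) ↔
      ∃ P₁ P₂ : Finset (Fin n), Disjoint P₁ P₂ ∧ P₁ ∪ P₂ = Finset.univ ∧
        P₁.card = n / 2 ∧ P₂.card = (n + 1) / 2 ∧
        ∀ (i : Fin p) (x y : Fin n),
          (G i).Adj x y ↔ (x ∈ P₁ ∧ y ∈ P₂) ∨ (x ∈ P₂ ∧ y ∈ P₁) := by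
  constructor
  · intro heq
    have htight := fun u v => h.colorCount_eq_of_sum_eq hp heq (u := u) (v := v)
    suffices ∃ P Q : Finset (Fin n), Disjoint P Q ∧ P ∪ Q = univ ∧
        ∀ (i : Fin p) (x y : Fin n), (G i).Adj x y ↔ (x ∈ P ∧ y ∈ Q) ∨ (x ∈ Q ∧ y ∈ P) by
      obtain ⟨P, Q, hPQ, hun, hG⟩ := this
      have hcard : #P + #Q = n := by rw [← card_union_of_disjoint hPQ, hun, card_fin]
      have hmul : #P * #Q = n ^ 2 / 4 := by
        simp only [card_edgeFinset_of_adj_iff _ hPQ (hG _), sum_const, card_fin,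
          smul_eq_mul] at heq
        exact Nat.eq_of_mul_eq_mul_left (by omega) heq
      rcases le_total #P #Q with hle | hle
      · obtain ⟨h₁, h₂⟩ := halves_of_mul_eq hle hcard hmul
        exact ⟨P, Q, hPQ, hun, h₁, h₂, hG⟩
      · obtain ⟨h₁, h₂⟩ := halves_of_mul_eq hle ((add_comm _ _).trans hcard)
          ((mul_comm _ _).trans hmul)
        exact ⟨Q, P, hPQ.symm, by rw [union_comm, hun], h₁, h₂,
          fun i x y => (hG i x y).trans or_comm⟩
    by_cases hE : ∃ u v, 0 < colorCount G u v
    · obtain ⟨u, v, huv⟩ := hE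
      have hall : ∀ {x y : Fin n} (i : Fin p), (G i).Adj x y ↔ 0 < colorCount G x y :=
        fun i => ⟨fun hi => (colorCount_pos G).2 ⟨i, hi⟩,
          fun hpos => (colorCount_eq_iff G).1 (htight _ _ hpos).1 i⟩
      have hxor : ∀ u v, 0 < colorCount G u v →
          ∀ z, 0 < colorCount G u z ↔ ¬ 0 < colorCount G v z := by
        intro u v huv z
        have hz := (htight u v huv).2 z
        refine ⟨fun hu hv => ?_, fun hv => by omega⟩
        have h₁ := (htight u z hu).1
        have h₂ := (htight v z hv).1
        omega
      have hbip := adj_iff_of_adj_xor (fun x y hxy => colorCount_comm G x y ▸ hxy) hxor huv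
      refine ⟨univ.filter (0 < colorCount G u ·), univ.filter (0 < colorCount G v ·),
        ?_, ?_, ?_⟩
      · exact disjoint_filter.2 fun z _ => (hxor u v huv z).1
      · ext z
        have := hxor u v huv z
        simp only [mem_union, mem_filter, mem_univ, true_and, iff_true]
        tauto
      · intro i x y
        simpa only [hall, mem_filter, mem_univ, true_and] using hbip x y
    · exact ⟨∅, univ, disjoint_empty_left _, empty_union _, fun i x y => by
        simpa using fun hi => hE ⟨x, y, (colorCount_pos G).2 ⟨i, hi⟩⟩⟩
  · rintro ⟨P, Q, hPQ, -, hP, hQ, hG⟩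
    simp only [card_edgeFinset_of_adj_iff _ hPQ (hG _), hP, hQ, half_mul_half_succ, sum_const,
      card_fin, smul_eq_mul]
end

section
/- Let p ≥ 2 and let G_1,…,G_p be graphs on vertex set [n] that are 2-colored triangle free. If {x,y} ∈ E(G_1) and x and y have a common neighbour in G_1 (i.e., N_{G_1}(x) ∩ N_{G_1}(y) ≠ ∅), then for every i with 2 ≤ i ≤ p one has deg_{G_i}(x) + deg_{G_i}(y) + deg_{G_1}(x) + deg_{G_1}(y) ≤ 2n − 2. -/
open Finset

/-- The degree of a vertex as a sum of adjacency indicators over all vertices. -/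
theorem degree_eq_sum_ite {V : Type*} [Fintype V] (G : SimpleGraph V) [DecidableRel G.Adj]
    (v : V) : G.degree v = ∑ w, if G.Adj v w then 1 else 0 := by
  rw [← SimpleGraph.card_neighborFinset_eq_degree, SimpleGraph.neighborFinset_eq_filter,
    Finset.card_filter]

theorem two_colored_degree_bound (n p : ℕ) (hp : 2 ≤ p)
    (G : Fin p → SimpleGraph (Fin n)) [∀ i, DecidableRel (G i).Adj]
    (h : TwoColoredTriangleFree G)
    (x y : Fin n) (hxy : (G ⟨0, by omega⟩).Adj x y)
    (hcommon : ∃ z : Fin n, (G ⟨0, by omega⟩).Adj x z ∧ (G ⟨0, by omega⟩).Adj y z)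
    (i : Fin p) (hi : i ≠ ⟨0, by omega⟩) :
    (G i).degree x + (G i).degree y +
      (G ⟨0, by omega⟩).degree x + (G ⟨0, by omega⟩).degree y ≤ 2 * n - 2 := by
  obtain ⟨z, hxz, hyz⟩ := hcommon
  revert hi
  generalize (⟨0, by omega⟩ : Fin p) = c at *
  intro hi
  have hfree : ∀ {j k : Fin p} {u v w : Fin n}, j ≠ k →
      (G j).Adj u v → (G j).Adj u w → ¬ (G k).Adj v w :=
    fun hjk huv huw hvw => h ⟨_, _, _, _, _, hjk, huv, huw, hvw⟩
  have hBxy : ¬ (G i).Adj x y := hfree hi.symm hxz.symm hyz.symm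
  have hBxw : ∀ w, (G c).Adj x w → ¬ (G i).Adj y w := fun w => hfree hi.symm hxy
  have hByw : ∀ w, (G c).Adj y w → ¬ (G i).Adj x w := fun w => hfree hi.symm hxy.symm
  have hBB : ∀ w, (G i).Adj x w → ¬ (G i).Adj y w :=
    fun w hx hy => hfree hi hx.symm hy.symm hxy
  have key : ∀ w, (if (G i).Adj x w then 1 else 0) + (if (G i).Adj y w then 1 else 0) +
      (if (G c).Adj x w then 1 else 0) + (if (G c).Adj y w then 1 else 0) +
      (if w = x then 1 else 0) + (if w = y then 1 else 0) ≤ 2 := by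
    intro w
    by_cases hwx : w = x
    · subst hwx
      simp [hxy.ne, hxy.symm, mt SimpleGraph.Adj.symm hBxy]
    by_cases hwy : w = y
    · subst hwy
      simp [hxy.ne', hxy, hBxy]
    have h₁ := hBxw w
    have h₂ := hByw w
    have h₃ := hBB w
    simp only [hwx, hwy, if_false]
    split_ifs <;> simp_all
  have hsum := Finset.sum_le_sum fun w (_ : w ∈ Finset.univ) => key w
  simp only [Finset.sum_add_distrib, ← degree_eq_sum_ite, Finset.sum_ite_eq', Finset.mem_univ,
    if_true, Finset.sum_const, Finset.card_univ, Fintype.card_fin, smul_eq_mul] at hsum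
  omega
end

section
/- Let 0 < α < 1/4 and let G_1, G_2, G_3 be graphs on vertex set [n] that are 2-colored triangle free. If E(G_1) ∩ E(G_2) = ∅, e(G_1) > n²/4 − αn², and e(G_2) > n²/4 − αn², then the maximum degree of G_3 satisfies Δ(G_3) < 2√α·n. -/
open Finset

/-- If two edge-disjoint graphs have no edge inside `A`, then their edges together with the
pairs inside `A` number at most `(n choose 2)`. -/
lemma card_edges_add_choose_le {V : Type*} [Fintype V] [DecidableEq V] (G H : SimpleGraph V)
    [DecidableRel G.Adj] [DecidableRel H.Adj] (A : Finset V)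
    (hGH : Disjoint G.edgeFinset H.edgeFinset)
    (hG : ∀ x ∈ A, ∀ y ∈ A, ¬ G.Adj x y) (hH : ∀ x ∈ A, ∀ y ∈ A, ¬ H.Adj x y) :
    G.edgeFinset.card + H.edgeFinset.card + A.card.choose 2 ≤ (Fintype.card V).choose 2 := by
  have hdisj : Disjoint (G.edgeFinset ∪ H.edgeFinset) (A.offDiag.image Sym2.mk.uncurry) := by
    rw [Finset.disjoint_right]
    intro e he
    obtain ⟨⟨x, y⟩, hxy, rfl⟩ := Finset.mem_image.1 he
    rw [Finset.mem_offDiag] at hxy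
    simp [hG x hxy.1 y hxy.2.1, hH x hxy.1 y hxy.2.1]
  rw [← Finset.card_union_of_disjoint hGH, ← Sym2.card_image_offDiag,
    ← Finset.card_union_of_disjoint hdisj, ← Finset.card_univ, ← Sym2.card_image_offDiag]
  refine Finset.card_le_card fun e => ?_
  induction e with
  | _ x y =>
    intro he
    refine Finset.mem_image.2 ⟨(x, y), ?_, rfl⟩
    simp only [Finset.mem_offDiag, Finset.mem_univ, true_and]
    rintro rfl
    simp at he

theorem two_colored_max_degree (n : ℕ) (α : ℝ) (hα0 : 0 < α) (hα : α < 1 / 4)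
    (G : Fin 3 → SimpleGraph (Fin n)) [∀ i, DecidableRel (G i).Adj]
    (h : TwoColoredTriangleFree G)
    (hdisj : Disjoint (G 0).edgeFinset (G 1).edgeFinset)
    (h1 : ((G 0).edgeFinset.card : ℝ) > (n : ℝ) ^ 2 / 4 - α * (n : ℝ) ^ 2)
    (h2 : ((G 1).edgeFinset.card : ℝ) > (n : ℝ) ^ 2 / 4 - α * (n : ℝ) ^ 2) :
    ((G 2).maxDegree : ℝ) < 2 * Real.sqrt α * (n : ℝ) := by
  rcases Nat.eq_zero_or_pos n with rfl | hn
  · simp [SimpleGraph.edgeFinset, Set.toFinset_card] at h1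
  have : Nonempty (Fin n) := ⟨⟨0, hn⟩⟩
  obtain ⟨v, hv⟩ := (G 2).exists_maximal_degree_vertex
  have hind : ∀ j, j ≠ 2 → ∀ x ∈ (G 2).neighborFinset v, ∀ y ∈ (G 2).neighborFinset v,
      ¬ (G j).Adj x y := by
    intro j hj x hx y hy hxy
    rw [SimpleGraph.mem_neighborFinset] at hx hy
    exact h ⟨2, j, v, x, y, hj.symm, hx, hy, hxy⟩
  have key := card_edges_add_choose_le (G 0) (G 1) ((G 2).neighborFinset v) hdisj
    (hind 0 (by decide)) (hind 1 (by decide))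
  rw [SimpleGraph.card_neighborFinset_eq_degree, ← hv, Fintype.card_fin] at key
  have hd : (G 2).maxDegree ≤ n := by
    rw [hv]
    simpa using ((G 2).degree_lt_card_verts v).le
  generalize (G 2).maxDegree = d at *
  have hkey : ((G 0).edgeFinset.card : ℝ) + (G 1).edgeFinset.card + d * (d - 1) / 2
      ≤ n * (n - 1) / 2 := by
    rw [← Nat.cast_choose_two, ← Nat.cast_choose_two]
    exact_mod_cast key
  have hd' : (d : ℝ) ≤ n := by exact_mod_cast hd
  refine lt_of_pow_lt_pow_left₀ 2 (by positivity) ?_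
  rw [mul_pow, mul_pow, Real.sq_sqrt hα0.le]
  linarith
end
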